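/- arXiv:2403.12628 — 7 statements merged into one kernel-verified Lean document; each statement's English description precedes it below -/
import Mathlib

section
/- Let Ω be an open cone in a real Banach space (V, ‖·‖), let e ∈ Ω, and let ‖·‖_e be the order-unit seminorm induced by e. The following conditions are equivalent: (i) ‖·‖_e is a complete norm on V; (ii) Ω is normal, i.e. there exists γ > 0 such that 0 ≤ x ≤ y implies ‖x‖ ≤ γ‖y‖; (iii) ‖·‖_e is a norm equivalent to ‖·‖, i.e. there exist constants c, C > 0 with c‖x‖ ≤ ‖x‖_e ≤ C‖x‖ for all x ∈ V. -/
/-- The order-unit seminorm on `V` induced by a point `e` of a cone `Ω`: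
`‖x‖_e = inf {λ > 0 : -λ•e ≤ x ≤ λ•e}` where `x ≤ y ↔ y - x ∈ closure Ω`. -/
noncomputable def orderUnitSeminorm {V : Type*} [NormedAddCommGroup V] [NormedSpace ℝ V]
    (Ω : Set V) (e x : V) : ℝ :=
  sInf {l : ℝ | 0 < l ∧ x - (-(l • e)) ∈ closure Ω ∧ l • e - x ∈ closure Ω}

namespace OUS

def W (V : Type*) : Type _ := V

instance {V : Type*} [h : AddCommGroup V] : AddCommGroup (W V) := h
instance {V : Type*} [AddCommGroup V] [h : Module ℝ V] : Module ℝ (W V) := h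

lemma banach {V : Type*} [NormedAddCommGroup V] [NormedSpace ℝ V] [CompleteSpace V]
    (p : Seminorm ℝ V) (C : ℝ) (hC : ∀ x, p x ≤ C * ‖x‖) (h0 : ∀ x, p x = 0 → x = 0)
    (hc : ∀ u : ℕ → V,
          (∀ ε : ℝ, 0 < ε → ∃ M : ℕ, ∀ m ≥ M, ∀ n ≥ M, p (u m - u n) < ε) →
          ∃ x : V, ∀ ε : ℝ, 0 < ε → ∃ M : ℕ, ∀ n ≥ M, p (u n - x) < ε) :
    ∃ c : ℝ, 0 < c ∧ ∀ x, c * ‖x‖ ≤ p x := by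
  let _ : Norm (W V) := ⟨fun x => p (show V from x)⟩
  have core : NormedSpace.Core ℝ (W V) :=
    { norm_nonneg := fun x => apply_nonneg p (show V from x)
      norm_smul := fun a x => map_smul_eq_mul p a (show V from x)
      norm_triangle := fun x y => map_add_le_add p (show V from x) (show V from y)
      norm_eq_zero_iff := fun x => ⟨fun h => h0 _ h, fun h => by
        subst h; exact map_zero p⟩ }
  let _ : NormedAddCommGroup (W V) := NormedAddCommGroup.ofCore core
  let _ : NormedSpace ℝ (W V) := NormedSpace.ofCore core
  have : CompleteSpace (W V) := by
    apply Metric.complete_of_cauchySeq_tendsto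
    intro u hu
    rw [Metric.cauchySeq_iff] at hu
    obtain ⟨x, hx⟩ := hc u (fun ε hε => by
      obtain ⟨N, hN⟩ := hu ε hε
      refine ⟨N, fun m hm n hn => ?_⟩
      have := hN m hm n hn
      rw [dist_eq_norm] at this
      exact this)
    refine ⟨(show W V from x), Metric.tendsto_atTop.2 ?_⟩
    intro ε hε
    obtain ⟨N, hN⟩ := hx ε hε
    refine ⟨N, fun n hn => ?_⟩
    rw [dist_eq_norm]
    exact hN n hn
  let f : V →ₗ[ℝ] W V :=
    { toFun := fun x => x
      map_add' := fun _ _ => rfl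
      map_smul' := fun _ _ => rfl }
  let F : V →L[ℝ] W V := f.mkContinuous C hC
  obtain ⟨D, hD, h⟩ := F.exists_preimage_norm_le (fun y => ⟨y, rfl⟩)
  refine ⟨D⁻¹, inv_pos.2 hD, fun x => ?_⟩
  obtain ⟨y, hy, hle⟩ := h (F x)
  have : y = x := hy
  subst this
  rw [inv_mul_le_iff₀ hD]
  exact hle

section
variable {V : Type*} [NormedAddCommGroup V] [NormedSpace ℝ V] {Ω : Set V} {e : V}

lemma cadd (hadd : ∀ x ∈ Ω, ∀ y ∈ Ω, x + y ∈ Ω) {x y : V} (hx : x ∈ closure Ω)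
    (hy : y ∈ closure Ω) : x + y ∈ closure Ω :=
  map_mem_closure₂ continuous_add hx hy hadd

lemma czero (hsmul : ∀ α : ℝ, 0 < α → ∀ x ∈ Ω, α • x ∈ Ω) (he : e ∈ Ω) :
    (0 : V) ∈ closure Ω := by
  have hcl : IsClosed {t : ℝ | t • e ∈ closure Ω} :=
    isClosed_closure.preimage (by fun_prop : Continuous fun t : ℝ => t • e)
  have hsub : Set.Ioi (0 : ℝ) ⊆ {t : ℝ | t • e ∈ closure Ω} :=
    fun t ht => subset_closure (hsmul t ht e he)
  have := closure_minimal hsub hcl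
  rw [closure_Ioi] at this
  simpa using this (Set.self_mem_Ici (a := (0 : ℝ)))

lemma csmul (hsmul : ∀ α : ℝ, 0 < α → ∀ x ∈ Ω, α • x ∈ Ω) (he : e ∈ Ω) {a : ℝ} (ha : 0 ≤ a)
    {x : V} (hx : x ∈ closure Ω) : a • x ∈ closure Ω := by
  rcases ha.eq_or_lt with rfl | h
  · simpa using czero hsmul he
  · exact map_mem_closure (continuous_const_smul a) hx (hsmul a h)

lemma p_nonneg (x : V) : 0 ≤ orderUnitSeminorm Ω e x :=
  Real.sInf_nonneg fun _ h => h.1.le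

lemma p_le (hadd : ∀ x ∈ Ω, ∀ y ∈ Ω, x + y ∈ Ω)
    (hsmul : ∀ α : ℝ, 0 < α → ∀ x ∈ Ω, α • x ∈ Ω) (he : e ∈ Ω) {x : V} {l : ℝ} (hl : 0 ≤ l)
    (h1 : l • e + x ∈ closure Ω) (h2 : l • e - x ∈ closure Ω) :
    orderUnitSeminorm Ω e x ≤ l := by
  refine le_of_forall_pos_le_add fun ε hε => ?_
  have hε' : ε • e ∈ closure Ω := subset_closure (hsmul ε hε e he)
  refine csInf_le ⟨0, fun _ h => h.1.le⟩ ⟨by linarith, ?_, ?_⟩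
  · convert cadd hadd h1 hε' using 1
    module
  · convert cadd hadd h2 hε' using 1
    module

lemma exists_bound (hopen : IsOpen Ω)
    (hsmul : ∀ α : ℝ, 0 < α → ∀ x ∈ Ω, α • x ∈ Ω) (he : e ∈ Ω) :
    ∃ C : ℝ, 0 < C ∧ ∀ (x : V) (l : ℝ), 0 < l → C * ‖x‖ ≤ l →
      l • e + x ∈ closure Ω ∧ l • e - x ∈ closure Ω := by
  obtain ⟨r, hr, hb⟩ := Metric.isOpen_iff.1 hopen e he
  have key : ∀ (x : V) (l : ℝ), 0 < l → 2 / r * ‖x‖ ≤ l → l • e + x ∈ closure Ω := by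
    intro x l hl h
    have h1 : e + l⁻¹ • x ∈ Ω := by
      apply hb
      rw [Metric.mem_ball, dist_eq_norm, add_sub_cancel_left, norm_smul, Real.norm_eq_abs,
        abs_of_pos (inv_pos.2 hl), inv_mul_lt_iff₀ hl]
      rw [div_mul_eq_mul_div, div_le_iff₀ hr] at h
      have : 0 < l * r := by positivity
      linarith
    have h2 := hsmul l hl _ h1
    rw [smul_add, smul_inv_smul₀ hl.ne'] at h2
    exact subset_closure h2
  refine ⟨2 / r, by positivity, fun x l hl h => ⟨key x l hl h, ?_⟩⟩
  rw [sub_eq_add_neg]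
  exact key (-x) l hl (by rwa [norm_neg])

lemma p_mem (hopen : IsOpen Ω) (hadd : ∀ x ∈ Ω, ∀ y ∈ Ω, x + y ∈ Ω)
    (hsmul : ∀ α : ℝ, 0 < α → ∀ x ∈ Ω, α • x ∈ Ω) (he : e ∈ Ω) (x : V) :
    orderUnitSeminorm Ω e x • e + x ∈ closure Ω ∧
    orderUnitSeminorm Ω e x • e - x ∈ closure Ω := by
  obtain ⟨C, hC, hb⟩ := exists_bound hopen hsmul he
  have hcl : IsClosed {t : ℝ | t • e + x ∈ closure Ω ∧ t • e - x ∈ closure Ω} :=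
    (isClosed_closure.preimage (by fun_prop : Continuous fun t : ℝ => t • e + x)).inter
    (isClosed_closure.preimage (by fun_prop : Continuous fun t : ℝ => t • e - x))
  have hsub : Set.Ioi (orderUnitSeminorm Ω e x) ⊆
      {t : ℝ | t • e + x ∈ closure Ω ∧ t • e - x ∈ closure Ω} := by
    intro t ht
    have hne : {l : ℝ | 0 < l ∧ x - (-(l • e)) ∈ closure Ω ∧ l • e - x ∈ closure Ω}.Nonempty := by
      have hp : 0 < C * ‖x‖ + 1 := by positivity
      have := hb x (C * ‖x‖ + 1) hp (by linarith)
      exact ⟨C * ‖x‖ + 1, hp, by rw [sub_neg_eq_add, add_comm]; exact this.1, this.2⟩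
    obtain ⟨l, ⟨hl, h1, h2⟩, hlt⟩ := exists_lt_of_csInf_lt hne ht
    have h3 : (t - l) • e ∈ closure Ω := subset_closure (hsmul _ (by linarith) e he)
    constructor
    · convert cadd hadd h1 h3 using 1
      module
    · convert cadd hadd h2 h3 using 1
      module
  have := closure_minimal hsub hcl
  rw [closure_Ioi] at this
  exact this Set.self_mem_Ici

lemma p_bound (hopen : IsOpen Ω) (hadd : ∀ x ∈ Ω, ∀ y ∈ Ω, x + y ∈ Ω)
    (hsmul : ∀ α : ℝ, 0 < α → ∀ x ∈ Ω, α • x ∈ Ω) (he : e ∈ Ω) :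
    ∃ C : ℝ, 0 < C ∧ ∀ x : V, orderUnitSeminorm Ω e x ≤ C * ‖x‖ := by
  obtain ⟨C, hC, hb⟩ := exists_bound hopen hsmul he
  refine ⟨C, hC, fun x => le_of_forall_pos_le_add fun ε hε => ?_⟩
  have hp : 0 < C * ‖x‖ + ε := by positivity
  have := hb x (C * ‖x‖ + ε) hp (by linarith)
  exact p_le hadd hsmul he hp.le this.1 this.2

lemma p_seminorm (hopen : IsOpen Ω) (hadd : ∀ x ∈ Ω, ∀ y ∈ Ω, x + y ∈ Ω)
    (hsmul : ∀ α : ℝ, 0 < α → ∀ x ∈ Ω, α • x ∈ Ω) (he : e ∈ Ω) :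
    ∃ p : Seminorm ℝ V, ∀ x, p x = orderUnitSeminorm Ω e x := by
  have hm := p_mem hopen hadd hsmul he
  refine ⟨Seminorm.ofSMulLE (orderUnitSeminorm Ω e) ?_ ?_ ?_, fun x => rfl⟩
  · obtain ⟨C, -, h⟩ := p_bound hopen hadd hsmul he
    have := h 0
    simp only [norm_zero, mul_zero] at this
    exact le_antisymm this (p_nonneg _)
  · intro x y
    refine p_le hadd hsmul he (add_nonneg (p_nonneg _) (p_nonneg _)) ?_ ?_
    · convert cadd hadd (hm x).1 (hm y).1 using 1
      module
    · convert cadd hadd (hm x).2 (hm y).2 using 1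
      module
  · intro a x
    refine p_le hadd hsmul he (mul_nonneg (norm_nonneg _) (p_nonneg _)) ?_ ?_
    all_goals
      rw [Real.norm_eq_abs]
      rcases le_total 0 a with h | h
      · rw [abs_of_nonneg h]
        first
        | (convert csmul hsmul he h (hm x).1 using 1; module)
        | (convert csmul hsmul he h (hm x).2 using 1; module)
      · rw [abs_of_nonpos h]
        have h' : 0 ≤ -a := by linarith
        first
        | (convert csmul hsmul he h' (hm x).1 using 1; module)
        | (convert csmul hsmul he h' (hm x).2 using 1; module)

end

end OUS

/-- For an open cone `Ω` in a real Banach space `V` with `e ∈ Ω`, the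
following are equivalent: (i) the order-unit seminorm `‖·‖_e` is a complete norm;
(ii) `Ω` is normal; (iii) `‖·‖_e` is a norm equivalent to the given norm of `V`. -/
theorem orderUnitSeminorm_completeNorm_iff_normal_iff_equivalent
    {V : Type*} [NormedAddCommGroup V] [NormedSpace ℝ V] [CompleteSpace V]
    (Ω : Set V) (hne : Ω.Nonempty) (hopen : IsOpen Ω)
    (hadd : ∀ x ∈ Ω, ∀ y ∈ Ω, x + y ∈ Ω)
    (hsmul : ∀ α : ℝ, 0 < α → ∀ x ∈ Ω, α • x ∈ Ω)
    (e : V) (he : e ∈ Ω) :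
    -- (i) `‖·‖_e` is a complete norm
    (((∀ x : V, orderUnitSeminorm Ω e x = 0 ↔ x = 0) ∧
        (∀ u : ℕ → V,
          (∀ ε : ℝ, 0 < ε → ∃ M : ℕ, ∀ m ≥ M, ∀ n ≥ M,
            orderUnitSeminorm Ω e (u m - u n) < ε) →
          ∃ x : V, ∀ ε : ℝ, 0 < ε → ∃ M : ℕ, ∀ n ≥ M,
            orderUnitSeminorm Ω e (u n - x) < ε))
      ↔
    -- (ii) `Ω` is normal
      (∃ γ : ℝ, 0 < γ ∧ ∀ x y : V, x ∈ closure Ω → y - x ∈ closure Ω →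
        ‖x‖ ≤ γ * ‖y‖)) ∧
    -- (ii) ↔ (iii) `‖·‖_e` is equivalent to `‖·‖`
    ((∃ γ : ℝ, 0 < γ ∧ ∀ x y : V, x ∈ closure Ω → y - x ∈ closure Ω →
        ‖x‖ ≤ γ * ‖y‖)
      ↔
      (∃ c C : ℝ, 0 < c ∧ 0 < C ∧ ∀ x : V,
        c * ‖x‖ ≤ orderUnitSeminorm Ω e x ∧ orderUnitSeminorm Ω e x ≤ C * ‖x‖)) := by
  have hm := OUS.p_mem hopen hadd hsmul he
  obtain ⟨C, hC, hb⟩ := OUS.p_bound hopen hadd hsmul he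
  have h23 : (∃ γ : ℝ, 0 < γ ∧ ∀ x y : V, x ∈ closure Ω → y - x ∈ closure Ω →
        ‖x‖ ≤ γ * ‖y‖)
      ↔
      (∃ c C : ℝ, 0 < c ∧ 0 < C ∧ ∀ x : V,
        c * ‖x‖ ≤ orderUnitSeminorm Ω e x ∧ orderUnitSeminorm Ω e x ≤ C * ‖x‖) := by
    constructor
    · rintro ⟨γ, hγ, h⟩
      have hD : 0 < (2 * γ + 1) * ‖e‖ + 1 := by positivity
      refine ⟨((2 * γ + 1) * ‖e‖ + 1)⁻¹, C, inv_pos.2 hD, hC, fun x => ⟨?_, hb x⟩⟩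
      rw [inv_mul_le_iff₀ hD]
      have hp : 0 ≤ orderUnitSeminorm Ω e x := OUS.p_nonneg x
      obtain ⟨h1, h2⟩ := hm x
      set l := orderUnitSeminorm Ω e x
      have h3 := h (l • e + x) ((2 * l) • e) h1 (by convert h2 using 1; module)
      have h4 : ‖x‖ ≤ ‖l • e + x‖ + ‖l • e‖ := by
        have := norm_sub_le (l • e + x) (l • e)
        rwa [add_sub_cancel_left] at this
      rw [norm_smul, Real.norm_of_nonneg (by positivity)] at h3
      rw [norm_smul l, Real.norm_of_nonneg hp] at h4
      nlinarith
    · rintro ⟨c, C, hc, hC, h⟩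
      refine ⟨C / c, by positivity, fun x y hx hyx => ?_⟩
      have hxy : orderUnitSeminorm Ω e x ≤ orderUnitSeminorm Ω e y := by
        refine OUS.p_le hadd hsmul he (OUS.p_nonneg _) ?_ ?_
        · exact OUS.cadd hadd (OUS.csmul hsmul he (OUS.p_nonneg _) (subset_closure he)) hx
        · convert OUS.cadd hadd (hm y).2 hyx using 1
          module
      rw [div_mul_eq_mul_div, le_div_iff₀ hc]
      linarith [(h x).1, (h y).2]
  refine ⟨?_, h23⟩
  rw [h23]
  obtain ⟨p, hp⟩ := OUS.p_seminorm hopen hadd hsmul he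
  constructor
  · rintro ⟨h0, hcomp⟩
    obtain ⟨c, hc, h⟩ := OUS.banach p C (fun x => by rw [hp]; exact hb x)
      (fun x hx => (h0 x).1 (by rw [← hp]; exact hx)) (by simpa only [hp] using hcomp)
    exact ⟨c, C, hc, hC, fun x => ⟨by rw [← hp]; exact h x, hb x⟩⟩
  · rintro ⟨c, C, hc, hC, h⟩
    refine ⟨fun x => ⟨fun hx => ?_, fun hx => ?_⟩, fun u hu => ?_⟩
    · have := (h x).1
      rw [hx] at this
      by_contra hne
      have := mul_pos hc (norm_pos_iff.2 hne)
      linarith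
    · rw [hx, ← hp, map_zero]
    · have hcs : CauchySeq u := by
        rw [Metric.cauchySeq_iff]
        intro ε hε
        obtain ⟨M, hM⟩ := hu (c * ε) (by positivity)
        refine ⟨M, fun m hm n hn => ?_⟩
        rw [dist_eq_norm]
        exact lt_of_mul_lt_mul_left ((h _).1.trans_lt (hM m hm n hn)) hc.le
      obtain ⟨x, hx⟩ := cauchySeq_tendsto_of_complete hcs
      refine ⟨x, fun ε hε => ?_⟩
      obtain ⟨M, hM⟩ := Metric.tendsto_atTop.1 hx (ε / C) (by positivity)
      refine ⟨M, fun n hn => (h _).2.trans_lt ?_⟩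
      have := hM n hn
      rw [dist_eq_norm, lt_div_iff₀ hC] at this
      linarith
end

section
/- Let Ω be an open cone in a real Banach space V, let W be a real normed space, and let J : Ω → W be a continuous, additive and positively homogeneous map. Then the unique linear extension J_V : V → W of J (defined by J_V(ω₁ − ω₂) = J(ω₁) − J(ω₂)) is continuous. -/
/-- If `J` is a continuous, additive and positively homogeneous map from an
open cone `Ω` of a real Banach space `V` into a real normed space `W`, then its linear
extension `J_V : V → W` (defined by `J_V(ω₁ - ω₂) = J(ω₁) - J(ω₂)`) is continuous. -/
theorem linear_extension_of_continuous_cone_map_continuous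
    {V : Type*} [NormedAddCommGroup V] [NormedSpace ℝ V] [CompleteSpace V]
    {W : Type*} [NormedAddCommGroup W] [NormedSpace ℝ W]
    (Ω : Set V) (hne : Ω.Nonempty) (hopen : IsOpen Ω)
    (hadd : ∀ x ∈ Ω, ∀ y ∈ Ω, x + y ∈ Ω)
    (hsmul : ∀ α : ℝ, 0 < α → ∀ x ∈ Ω, α • x ∈ Ω)
    (J : V → W) (hJcont : ContinuousOn J Ω)
    (hJadd : ∀ x ∈ Ω, ∀ y ∈ Ω, J (x + y) = J x + J y)
    (hJhom : ∀ α : ℝ, 0 < α → ∀ x ∈ Ω, J (α • x) = α • J x)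
    (T : V →ₗ[ℝ] W) (hT : ∀ x ∈ Ω, ∀ y ∈ Ω, T (x - y) = J x - J y) :
    Continuous T := by
  obtain ⟨w, hw⟩ := hne
  have hc : ContinuousAt J w := hJcont.continuousAt (hopen.mem_nhds hw)
  have ht : Filter.Tendsto (fun v : V => v + w) (nhds 0) (nhds w) := by
    have h : Continuous (fun v : V => v + w) := by fun_prop
    simpa using h.tendsto 0
  refine continuous_of_continuousAt_zero T ?_
  have h1 : Filter.Tendsto (fun v : V => J (v + w) - J w) (nhds 0) (nhds 0) := by
    have h := (Filter.Tendsto.comp hc ht).sub_const (J w)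
    simpa [Function.comp_def] using h
  have h2 : (fun v : V => J (v + w) - J w) =ᶠ[nhds 0] T := by
    filter_upwards [ht (hopen.mem_nhds hw)] with v hv
    have h := hT (v + w) hv w hw
    rw [add_sub_cancel_right] at h
    exact h.symm
  have h3 := h1.congr' h2
  simpa [ContinuousAt] using h3
end

section
/- Let V be a unital JB-algebra with identity e, and let J : V → B(V) be a continuous linear map into the bounded linear operators on V such that each J(a) is a continuous derivation of the Jordan product and J(J(a)(b)) = L_b L_a − L_a L_b for all a, b ∈ V. Then J is antisymmetric: J(a)(b) = −J(b)(a) for all a, b ∈ V; in particular J(a)(a) = 0 for all a ∈ V. -/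
def adR {R : Type*} [Ring R] (A : R) (x : R) : R := x * A - A * x

lemma adR_leib {R : Type*} [Ring R] (A D : R) (h : adR A (adR A D) = 0) (x : R) (k : ℕ) :
    (adR A)^[k+1] (x * D) = (adR A)^[k+1] x * D + ((k+1 : ℕ) : R) * ((adR A)^[k] x * adR A D) := by
  induction k with
  | zero => simp [adR]; noncomm_ring
  | succ k ih =>
    rw [Function.iterate_succ_apply', ih, Function.iterate_succ_apply' _ (k+1) x]
    rw [Function.iterate_succ_apply' _ k x]
    generalize (adR A)^[k] x = y
    have hc := Nat.cast_commute (k+1) A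
    have hc' : ((k+1 : ℕ) : R) * A = A * ((k+1 : ℕ) : R) := hc
    have h1 : adR A (adR A y * D + ((k+1:ℕ):R) * (y * adR A D)) = adR A (adR A y * D) + ((k+1:ℕ):R) * adR A (y * adR A D) := by
      simp only [adR]
      generalize ((k+1:ℕ):R) = c at hc'
      simp only [mul_sub, sub_mul, mul_add, add_mul, ← mul_assoc, hc']
      noncomm_ring
    have h2 : adR A (adR A y * D) = adR A (adR A y) * D + adR A y * adR A D := by
      simp only [adR]; noncomm_ring
    have h3 : adR A (y * adR A D) = adR A y * adR A D := by
      have : adR A (y * adR A D) = adR A y * adR A D + y * adR A (adR A D) := by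
        simp only [adR]; noncomm_ring
      rw [this, h]; simp
    rw [h1, h2, h3]
    push_cast
    noncomm_ring

lemma adR_zero {R : Type*} [Ring R] (A : R) : adR A 0 = 0 := by simp [adR]

lemma adR_pow {R : Type*} [Ring R] (A D : R) (h : adR A (adR A D) = 0) (n : ℕ) :
    (adR A)^[n] (D ^ n) = (n.factorial : R) * (adR A D) ^ n ∧ (adR A)^[n+1] (D ^ n) = 0 := by
  induction n with
  | zero => simp [adR]
  | succ n ih =>
    obtain ⟨h1, h2⟩ := ih
    constructor
    · rw [pow_succ, adR_leib A D h, h2, h1, Nat.factorial_succ]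
      push_cast; simp [pow_succ, mul_assoc]
    · rw [pow_succ, adR_leib A D h, Function.iterate_succ_apply' _ (n+1), h2, adR_zero]; simp

lemma adR_norm {R : Type*} [NormedRing R] (A x : R) (n : ℕ) :
    ‖(adR A)^[n] x‖ ≤ (2 * ‖A‖) ^ n * ‖x‖ := by
  induction n with
  | zero => simp
  | succ n ih =>
    rw [Function.iterate_succ_apply']
    generalize (adR A)^[n] x = y at ih
    have h1 : ‖adR A y‖ ≤ ‖y‖ * ‖A‖ + ‖A‖ * ‖y‖ :=
      (norm_sub_le _ _).trans (add_le_add (norm_mul_le _ _) (norm_mul_le _ _))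
    calc _ ≤ (2 * ‖A‖) * ‖y‖ := by linarith
      _ ≤ (2 * ‖A‖) * ((2 * ‖A‖) ^ n * ‖x‖) := by gcongr
      _ = _ := by ring

/-- Let `V` be a unital JB-algebra (a real Banach space with a commutative
bilinear product `∘` satisfying the Jordan identity and the JB norm conditions, with
identity `e`), and let `J : V → B(V)` be a continuous linear map such that each `J a` is
a derivation of the Jordan product and `J (J a b) = L_b L_a - L_a L_b`. Then
`J a b = -(J b a)`; in particular `J a a = 0`. -/
theorem orientation_antisymmetric
    {V : Type*} [NormedAddCommGroup V] [NormedSpace ℝ V] [CompleteSpace V]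
    (mul : V →L[ℝ] V →L[ℝ] V)
    (hcomm : ∀ a b : V, mul a b = mul b a)
    (hjordan : ∀ a b : V, mul a (mul b (mul a a)) = mul (mul a b) (mul a a))
    (hnorm_mul : ∀ a b : V, ‖mul a b‖ ≤ ‖a‖ * ‖b‖)
    (hnorm_sq : ∀ a : V, ‖mul a a‖ = ‖a‖ ^ 2)
    (hnorm_add : ∀ a b : V, ‖mul a a‖ ≤ ‖mul a a + mul b b‖)
    (e : V) (he : ∀ a : V, mul e a = a)
    (J : V →L[ℝ] V →L[ℝ] V)
    (hder : ∀ a x y : V, J a (mul x y) = mul (J a x) y + mul x (J a y))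
    (hJ : ∀ a b : V, J (J a b) = mul b ∘L mul a - mul a ∘L mul b) :
    (∀ a b : V, J a b = -(J b a)) ∧ (∀ a : V, J a a = 0) := by
  have hcen : ∀ z, J z = 0 → ∀ b, mul b ∘L mul z = mul z ∘L mul b := by
    intro z hz b
    have := hJ z b
    rw [hz] at this
    simp only [ContinuousLinearMap.zero_apply, map_zero] at this
    exact sub_eq_zero.mp this.symm
  have hpow : ∀ (k : ℕ) (z : V), (∀ b c, mul b (mul z c) = mul z (mul b c)) →
      ‖z‖ ^ (2 ^ k) ≤ ‖(mul z) ^ (2 ^ k)‖ * ‖e‖ := by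
    intro k
    induction k with
    | zero =>
      intro z _
      have := (mul z).le_opNorm e
      rw [hcomm z e, he] at this
      simpa using this
    | succ k ih =>
      intro z hz
      have hsq : mul (mul z z) = (mul z) ^ 2 := by
        ext c
        rw [hcomm, hz, hcomm c z]; simp [pow_two]
      have := ih (mul z z) (by
        intro b c
        rw [hsq]; simp [pow_two, hz])
      rw [hnorm_sq, hsq, ← pow_mul, ← pow_mul] at this
      rw [pow_succ, mul_comm (2 ^ k) 2]
      exact this
  have hself : ∀ a : V, J a a = 0 := by
    intro a
    have hz : J (J a a) = 0 := by rw [hJ]; simp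
    have hE : adR (mul a) (J a) = mul (J a a) := by
      ext x
      simp [adR, hder]
    have hEE : adR (mul a) (adR (mul a) (J a)) = 0 := by
      rw [hE]
      exact sub_eq_zero.mpr (hcen _ hz a).symm
    by_contra hne
    have hr : 0 < ‖J a a‖ := norm_pos_iff.mpr hne
    have hzc : ∀ b c, mul b (mul (J a a) c) = mul (J a a) (mul b c) := fun b c =>
      DFunLike.congr_fun (hcen _ hz b) c
    set r := ‖J a a‖ with hrdef
    set C := 2 * ‖mul a‖ * ‖J a‖ with hC
    have hbound : ∀ n : ℕ, 0 < n → (n.factorial : ℝ) * ‖mul (J a a) ^ n‖ ≤ C ^ n := by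
      intro n hn
      have h1 := (adR_pow (mul a) (J a) hEE n).1
      have h2 := adR_norm (mul a) (J a ^ n) n
      rw [h1, hE, ← nsmul_eq_mul, ← Nat.cast_smul_eq_nsmul ℝ, norm_smul] at h2
      simp only [RCLike.norm_natCast] at h2
      refine h2.trans ?_
      rw [hC, mul_pow (2 * ‖mul a‖)]
      gcongr
      exact norm_pow_le' _ hn
    have hlim := (FloorSemiring.tendsto_pow_div_factorial_atTop (C / r)).mul_const ‖e‖
    rw [zero_mul] at hlim
    have hlim2 := hlim.comp (tendsto_pow_atTop_atTop_of_one_lt (one_lt_two : 1 < 2))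
    have hge : ∀ k : ℕ, 1 ≤ (C / r) ^ (2 ^ k) / ((2 ^ k).factorial : ℝ) * ‖e‖ := by
      intro k
      have h1 := hpow k _ hzc
      have h2 := hbound (2 ^ k) (by positivity)
      have hf : (0:ℝ) < ((2 ^ k).factorial : ℝ) := by exact_mod_cast Nat.factorial_pos _
      rw [div_pow, div_div, div_mul_eq_mul_div, le_div_iff₀ (by positivity), one_mul]
      calc _ ≤ (‖mul (J a a) ^ 2 ^ k‖ * ‖e‖) * ((2 ^ k).factorial : ℝ) := by gcongr
        _ = (((2 ^ k).factorial : ℝ) * ‖mul (J a a) ^ 2 ^ k‖) * ‖e‖ := by ring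
        _ ≤ _ := by gcongr
    have := ge_of_tendsto' hlim2 hge
    linarith
  refine ⟨fun a b => ?_, hself⟩
  have h := hself (a + b)
  simp only [map_add, ContinuousLinearMap.add_apply, hself, zero_add, add_zero] at h
  rw [eq_neg_iff_add_eq_zero, ← h]
  abel
end

section
/- Let V be a unital JB-algebra with identity e, and let J : V → B(V) be a continuous linear map into the bounded linear operators on V such that each J(a) is a continuous derivation of the Jordan product and J(J(a)(b)) = L_b L_a − L_a L_b for all a, b ∈ V. Then the kernel of J equals the centre of V: J(z) = 0 if and only if z ∈ Z(V) = {z ∈ V : z∘(x∘y) = x∘(z∘y) for all x, y ∈ V}. -/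
lemma kl_leib {A : Type*} [Ring A] (D : A →+ A) (hD : ∀ x y, D (x * y) = D x * y + x * D y)
    (b c : A) (hb : D b = c) (hc : D c = 0) (n : ℕ) (x : A) :
    D^[n+1] (b * x) = b * D^[n+1] x + (n+1 : ℕ) • (c * D^[n] x) := by
  induction n with
  | zero => simp [hD, hb, add_comm]
  | succ n ih =>
    rw [Function.iterate_succ_apply', ih, map_add, map_nsmul, hD, hD, hb, hc,
      ← Function.iterate_succ_apply' D, ← Function.iterate_succ_apply' D]
    rw [succ_nsmul (c * _) (n+1)]
    simp only [zero_mul, zero_add]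
    abel

lemma kl_main {A : Type*} [Ring A] (D : A →+ A) (hD : ∀ x y, D (x * y) = D x * y + x * D y)
    (b c : A) (hb : D b = c) (hc : D c = 0) (n : ℕ) :
    D^[n] (b ^ n) = n.factorial • c ^ n ∧ D^[n+1] (b ^ n) = 0 := by
  induction n with
  | zero =>
    have := hD 1 1
    simp at this
    simp [this]
  | succ n ih =>
    rw [pow_succ', kl_leib D hD b c hb hc, kl_leib D hD b c hb hc,
      Function.iterate_succ_apply' D (n+1), ih.2, ih.1]
    constructor
    · simp only [mul_zero, zero_add, mul_smul_comm, smul_smul, Nat.factorial_succ, pow_succ']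
    · simp

lemma kl_bound {A : Type*} [NormedRing A] [NormedSpace ℝ A] (a b c : A)
    (h : a * b - b * a = c) (hc : a * c = c * a) (n : ℕ) :
    (n.factorial : ℝ) * ‖c ^ n‖ ≤ (2 * ‖a‖) ^ n * ‖b ^ n‖ := by
  let D : A →+ A := AddMonoidHom.mulLeft a - AddMonoidHom.mulRight a
  have hDx : ∀ x, D x = a * x - x * a := fun x => rfl
  have key := (kl_main D (fun x y => by simp only [hDx]; noncomm_ring) b c (by rw [hDx, h])
    (by rw [hDx, hc, sub_self]) n).1
  have hit : ∀ (n : ℕ) (x : A), ‖D^[n] x‖ ≤ (2 * ‖a‖) ^ n * ‖x‖ := by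
    intro n x
    induction n with
    | zero => simp
    | succ n ih =>
      rw [Function.iterate_succ_apply', hDx]
      have h1 := norm_sub_le (a * D^[n] x) (D^[n] x * a)
      have h2 := norm_mul_le a (D^[n] x)
      have h3 := norm_mul_le (D^[n] x) a
      have h4 := mul_le_mul_of_nonneg_left ih (norm_nonneg a)
      rw [pow_succ]
      nlinarith
  have := hit n (b ^ n)
  rwa [key, ← Nat.cast_smul_eq_nsmul ℝ, norm_smul, Real.norm_natCast] at this


/-- Let `V` be a unital JB-algebra and `J : V → B(V)` a continuous linear
map such that each `J a` is a derivation of the Jordan product and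
`J (J a b) = L_b L_a - L_a L_b`. Then the kernel of `J` is the centre of `V`:
`J z = 0` iff `z ∘ (x ∘ y) = x ∘ (z ∘ y)` for all `x, y`. -/
theorem orientation_kernel_eq_centre
    {V : Type*} [NormedAddCommGroup V] [NormedSpace ℝ V] [CompleteSpace V]
    (mul : V →L[ℝ] V →L[ℝ] V)
    (hcomm : ∀ a b : V, mul a b = mul b a)
    (hjordan : ∀ a b : V, mul a (mul b (mul a a)) = mul (mul a b) (mul a a))
    (hnorm_mul : ∀ a b : V, ‖mul a b‖ ≤ ‖a‖ * ‖b‖)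
    (hnorm_sq : ∀ a : V, ‖mul a a‖ = ‖a‖ ^ 2)
    (hnorm_add : ∀ a b : V, ‖mul a a‖ ≤ ‖mul a a + mul b b‖)
    (e : V) (he : ∀ a : V, mul e a = a)
    (J : V →L[ℝ] V →L[ℝ] V)
    (hder : ∀ a x y : V, J a (mul x y) = mul (J a x) y + mul x (J a y))
    (hJ : ∀ a b : V, J (J a b) = mul b ∘L mul a - mul a ∘L mul b) :
    ∀ z : V, J z = 0 ↔ (∀ x y : V, mul z (mul x y) = mul x (mul z y)) := by
  have hfwd : ∀ z : V, J z = 0 → (∀ x y : V, mul z (mul x y) = mul x (mul z y)) := by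
    intro z hz x y
    have := congrArg (fun T : V →L[ℝ] V => T y) (hJ z x)
    simp [hz] at this
    exact (sub_eq_zero.mp this.symm).symm
  -- derivations kill the centre
  have hkill : ∀ (d : V →L[ℝ] V), (∀ x y : V, d (mul x y) = mul (d x) y + mul x (d y)) →
      ∀ w : V, (∀ x y : V, mul w (mul x y) = mul x (mul w y)) → d w = 0 := by
    intro d hd w hw
    have hdw : ∀ x y : V, mul (d w) (mul x y) = mul x (mul (d w) y) := by
      intro x y
      have h := congrArg d (hw x y)
      simp only [hd, map_add] at h
      rw [hw (d x) y, hw x (d y)] at h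
      have h' : mul (d w) (mul x y) + (mul (d x) (mul w y) + mul x (mul w (d y)))
          = mul x (mul (d w) y) + (mul (d x) (mul w y) + mul x (mul w (d y))) := by
        rw [h]; abel
      exact add_right_cancel h'
    have hpow : ∀ k : ℕ, ∃ y : V, mul y = (mul (d w)) ^ (2 ^ k) ∧ ‖y‖ = ‖d w‖ ^ (2 ^ k) ∧
        (∀ u v : V, mul y (mul u v) = mul u (mul y v)) := by
      intro k
      induction k with
      | zero => exact ⟨d w, by simp, by simp, hdw⟩
      | succ k ih =>
        obtain ⟨y, h1, h2, h3⟩ := ih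
        have hyy : ∀ v, mul (mul y y) v = mul y (mul y v) := by
          intro v
          rw [hcomm y v, h3 v y, hcomm]
        refine ⟨mul y y, ?_, ?_, ?_⟩
        · rw [pow_succ, pow_mul, ← h1, sq]
          ext v
          exact hyy v
        · rw [hnorm_sq, h2, ← pow_mul, pow_succ]
        · intro u v
          rw [hyy, hyy, h3 u v, h3 u]
    have hb := kl_bound (A := V →L[ℝ] V) (mul w) d (-(mul (d w))) (by
      ext v
      simp [hd]) (by
      ext v
      simp [hw])
    by_contra hne
    have hpos : 0 < ‖d w‖ := norm_pos_iff.mpr hne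
    set r : ℝ := 2 * ‖mul w‖ * ‖d‖ / ‖d w‖ with hr
    have hle : ∀ k : ℕ, 1 ≤ r ^ (2 ^ k) / ((2 ^ k).factorial : ℝ) * ‖e‖ := by
      intro k
      obtain ⟨y, h1, h2, -⟩ := hpow k
      have hN := hb (2 ^ k)
      have hf : (0 : ℝ) < ((2 ^ k).factorial : ℝ) := by positivity
      have e1 : ‖(-(mul (d w))) ^ (2 ^ k)‖ = ‖mul y‖ := by
        rw [h1]
        rw [neg_pow]
        rcases neg_one_pow_eq_or (V →L[ℝ] V) (2 ^ k) with h | h <;> rw [h] <;> simp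
      have e2 : ‖y‖ ≤ ‖mul y‖ * ‖e‖ := by
        have := (mul y).le_opNorm e
        rwa [hcomm, he] at this
      have e3 : ‖d ^ (2 ^ k)‖ ≤ ‖d‖ ^ (2 ^ k) := norm_pow_le' d (by positivity)
      rw [e1] at hN
      have e4 : ((2 ^ k).factorial : ℝ) * ‖mul y‖ ≤ (2 * ‖mul w‖ * ‖d‖) ^ (2 ^ k) := by
        rw [mul_pow]
        exact hN.trans (mul_le_mul_of_nonneg_left e3 (by positivity))
      rw [hr, div_pow, div_div, div_mul_eq_mul_div, le_div_iff₀ (by positivity), one_mul, ← h2]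
      calc ‖y‖ * ((2 ^ k).factorial : ℝ) ≤ (‖mul y‖ * ‖e‖) * ((2 ^ k).factorial : ℝ) := by gcongr
        _ = (((2 ^ k).factorial : ℝ) * ‖mul y‖) * ‖e‖ := by ring
        _ ≤ _ := by gcongr
    have ht := ((FloorSemiring.tendsto_pow_div_factorial_atTop r).comp
      (tendsto_pow_atTop_atTop_of_one_lt (one_lt_two : (1 : ℕ) < 2))).mul_const ‖e‖
    have := ge_of_tendsto' ht hle
    norm_num at this
  intro z
  refine ⟨hfwd z, fun hz => ?_⟩
  have hJ0 : ∀ b, J (J z b) = 0 := by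
    intro b
    rw [hJ]
    ext v
    simp [hz]
  have hdd : ∀ b, J z (J z b) = 0 := fun b => hkill (J z) (hder z) _ (hfwd _ (hJ0 b))
  ext b
  have h := hdd (mul b b)
  simp only [hder, map_add, hdd, map_zero, zero_apply, zero_add, add_zero] at h
  have h2 : mul (J z b) (J z b) = 0 := by
    rw [← two_smul ℝ] at h
    simpa using h
  have h3 := hnorm_sq (J z b)
  rw [h2, norm_zero] at h3
  have : ‖J z b‖ = 0 := by
    exact pow_eq_zero_iff (two_ne_zero) |>.mp h3.symm
  simpa using this
end

section
/- Let V be a unital JB-algebra with identity e, and let J : V → B(V) be a continuous linear map into the bounded linear operators on V such that each J(a) is a continuous derivation of the Jordan product and J(J(a)(b)) = L_b L_a − L_a L_b for all a, b ∈ V. Then [L_a, L_b] = [J(b), J(a)] for all a, b ∈ V, i.e. L_a L_b − L_b L_a = J(b)J(a) − J(a)J(b). -/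
section helpers

/-- Iterated commutator with `T`. -/
def adIter {A : Type*} [Ring A] (T : A) : ℕ → A → A
  | 0, X => X
  | n + 1, X => adIter T n X * T - T * adIter T n X

theorem adIter_mul {A : Type*} [Ring A] (T D C : A) (hC : C = D * T - T * D)
    (hCT : C * T = T * C) (k : ℕ) (X : A) :
    adIter T (k + 1) (X * D) = adIter T (k + 1) X * D + (k + 1 : ℕ) • (adIter T k X * C) := by
  have hD : D * T = C + T * D := by rw [hC]; abel
  induction k with
  | zero =>
    simp only [adIter, zero_add, one_smul]
    rw [hC]; noncomm_ring
  | succ k ih =>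
    rw [adIter, ih]
    have h1 : adIter T (k + 1 + 1) X = adIter T (k + 1) X * T - T * adIter T (k + 1) X := rfl
    have h2 : adIter T (k + 1) X = adIter T k X * T - T * adIter T k X := rfl
    rw [h1]
    have h3 : adIter T k X * C * T - T * (adIter T k X * C) = adIter T (k + 1) X * C := by
      rw [h2, mul_assoc, hCT]; noncomm_ring
    have h4 : adIter T (k + 1) X * D * T = adIter T (k + 1) X * C + adIter T (k + 1) X * T * D := by
      rw [mul_assoc, hD]; noncomm_ring
    rw [succ_nsmul _ (k + 1), ← h3, smul_sub, add_mul, h4, h3, mul_add, smul_mul_assoc,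
      mul_smul_comm]
    noncomm_ring

theorem adIter_pow {A : Type*} [Ring A] (T D C : A) (hC : C = D * T - T * D)
    (hCT : C * T = T * C) (n : ℕ) :
    adIter T n (D ^ n) = n.factorial • C ^ n ∧ adIter T (n + 1) (D ^ n) = 0 := by
  induction n with
  | zero => simp [adIter]
  | succ n ih =>
    have h1 : adIter T (n + 1) (D ^ (n + 1)) = (n + 1).factorial • C ^ (n + 1) := by
      rw [pow_succ, adIter_mul T D C hC hCT, ih.1, ih.2, Nat.factorial_succ, mul_smul, pow_succ,
        zero_mul, zero_add, smul_mul_assoc]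
    refine ⟨h1, ?_⟩
    rw [adIter, h1]
    have : C ^ (n + 1) * T = T * C ^ (n + 1) := (Commute.pow_left (show Commute C T from hCT) _)
    rw [smul_mul_assoc, mul_smul_comm, this, sub_self]

theorem adIter_norm {A : Type*} [NormedRing A] (T X : A) (n : ℕ) :
    ‖adIter T n X‖ ≤ (2 * ‖T‖) ^ n * ‖X‖ := by
  induction n with
  | zero => simp [adIter]
  | succ n ih =>
    rw [adIter]
    calc _ ≤ ‖adIter T n X * T‖ + ‖T * adIter T n X‖ := norm_sub_le _ _
      _ ≤ ‖adIter T n X‖ * ‖T‖ + ‖T‖ * ‖adIter T n X‖ :=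
        add_le_add (norm_mul_le _ _) (norm_mul_le _ _)
      _ = (2 * ‖T‖) * ‖adIter T n X‖ := by ring
      _ ≤ (2 * ‖T‖) * ((2 * ‖T‖) ^ n * ‖X‖) := by gcongr
      _ = _ := by ring

theorem der_central
    {V : Type*} [NormedAddCommGroup V] [NormedSpace ℝ V]
    (mul : V →L[ℝ] V →L[ℝ] V)
    (hcomm : ∀ a b : V, mul a b = mul b a)
    (hnorm_sq : ∀ a : V, ‖mul a a‖ = ‖a‖ ^ 2)
    (e : V) (he : ∀ a : V, mul e a = a)
    (D : V →L[ℝ] V)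
    (hder : ∀ x y : V, D (mul x y) = mul (D x) y + mul x (D y))
    (z : V) (hz : ∀ x y, mul z (mul x y) = mul x (mul z y)) : D z = 0 := by
  have hw : ∀ x y, mul (D z) (mul x y) = mul x (mul (D z) y) := by
    intro x y
    have h := congrArg D (hz x y)
    simp only [hder, map_add] at h
    rw [hz (D x) y, hz x (D y)] at h
    have h' : mul (D z) (mul x y) + (mul (D x) (mul z y) + mul x (mul z (D y)))
      = mul x (mul (D z) y) + (mul (D x) (mul z y) + mul x (mul z (D y))) := by
      rw [h]; abel
    exact add_right_cancel h'
  set w := D z with hwdef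
  have hC : mul w = D * mul z - mul z * D := by
    ext x
    simp [hder, hwdef]
  have hCT : mul w * mul z = mul z * mul w := by
    ext x
    simp [hw]
  have hq : ∀ k : ℕ, ∃ q : V, mul q = (mul w) ^ (2 ^ k) ∧ ‖q‖ = ‖w‖ ^ (2 ^ k) ∧
      (∀ x y, mul q (mul x y) = mul x (mul q y)) := by
    intro k
    induction k with
    | zero => exact ⟨w, by simp, by simp, hw⟩
    | succ k ih =>
      obtain ⟨q, h1, h2, h3⟩ := ih
      have h4 : mul (mul q q) = mul q * mul q := by
        ext x
        change mul (mul q q) x = mul q (mul q x)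
        rw [hcomm q x, h3 x q, hcomm x]
      refine ⟨mul q q, ?_, ?_, ?_⟩
      · rw [h4, h1, pow_succ 2 k, pow_mul, sq]
      · rw [hnorm_sq, h2, pow_succ 2 k, pow_mul]
      · intro x y
        rw [h4]
        change mul q (mul q _) = mul x (mul q (mul q y))
        rw [h3 x y, h3 x (mul q y)]
  by_contra hne
  have hpos : 0 < ‖w‖ := norm_pos_iff.mpr hne
  set K : ℝ := 2 * ‖mul z‖ * ‖D‖ with hK
  have key : ∀ k : ℕ, 1 ≤ ‖e‖ * ((K / ‖w‖) ^ (2 ^ k) / ((2 ^ k).factorial : ℝ)) := by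
    intro k
    obtain ⟨q, h1, h2, -⟩ := hq k
    have hn : 0 < 2 ^ k := by positivity
    generalize 2 ^ k = n at *
    have hf : (0 : ℝ) < (n.factorial : ℝ) := by exact_mod_cast n.factorial_pos
    have hA := adIter_norm (mul z) (D ^ n) n
    rw [(adIter_pow (mul z) D (mul w) hC hCT n).1, ← h1, ← Nat.cast_smul_eq_nsmul ℝ, norm_smul,
      Real.norm_of_nonneg hf.le] at hA
    have hB : ‖D ^ n‖ ≤ ‖D‖ ^ n := norm_pow_le' D hn
    have hE : ‖q‖ ≤ ‖mul q‖ * ‖e‖ := by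
      have := (mul q).le_opNorm e
      rwa [hcomm, he] at this
    have hKn : (n.factorial : ℝ) * ‖mul q‖ ≤ K ^ n := by
      rw [hK, mul_pow]
      exact hA.trans (by gcongr)
    rw [h2] at hE
    rw [div_pow, div_div, mul_div_assoc', le_div_iff₀ (by positivity), one_mul]
    calc ‖w‖ ^ n * n.factorial ≤ (‖mul q‖ * ‖e‖) * n.factorial := by gcongr
      _ = ‖e‖ * (n.factorial * ‖mul q‖) := by ring
      _ ≤ _ := by gcongr
  have ht := ((FloorSemiring.tendsto_pow_div_factorial_atTop (K / ‖w‖)).comp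
    (tendsto_pow_atTop_atTop_of_one_lt (one_lt_two : (1 : ℕ) < 2))).const_mul ‖e‖
  have := ge_of_tendsto' ht key
  norm_num at this

end helpers


/-- Let `V` be a unital JB-algebra and `J : V → B(V)` a continuous linear
map such that each `J a` is a derivation of the Jordan product and
`J (J a b) = L_b L_a - L_a L_b`. Then `[L_a, L_b] = [J b, J a]` for all `a, b ∈ V`. -/
theorem orientation_commutator_identity
    {V : Type*} [NormedAddCommGroup V] [NormedSpace ℝ V] [CompleteSpace V]
    (mul : V →L[ℝ] V →L[ℝ] V)
    (hcomm : ∀ a b : V, mul a b = mul b a)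
    (hjordan : ∀ a b : V, mul a (mul b (mul a a)) = mul (mul a b) (mul a a))
    (hnorm_mul : ∀ a b : V, ‖mul a b‖ ≤ ‖a‖ * ‖b‖)
    (hnorm_sq : ∀ a : V, ‖mul a a‖ = ‖a‖ ^ 2)
    (hnorm_add : ∀ a b : V, ‖mul a a‖ ≤ ‖mul a a + mul b b‖)
    (e : V) (he : ∀ a : V, mul e a = a)
    (J : V →L[ℝ] V →L[ℝ] V)
    (hder : ∀ a x y : V, J a (mul x y) = mul (J a x) y + mul x (J a y))
    (hJ : ∀ a b : V, J (J a b) = mul b ∘L mul a - mul a ∘L mul b) :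
    ∀ a b : V, mul a ∘L mul b - mul b ∘L mul a = J b ∘L J a - J a ∘L J b := by
  have hJ' : ∀ a b c, J (J a b) c = mul b (mul a c) - mul a (mul b c) := by
    intro a b c; rw [hJ]; rfl
  have hker : ∀ n, J n = 0 → ∀ x y, mul n (mul x y) = mul x (mul n y) := by
    intro n hn x y
    have := hJ' n x y
    simp only [hn, ContinuousLinearMap.zero_apply, map_zero] at this
    exact (sub_eq_zero.mp this.symm).symm
  have hdz : ∀ a z, J z = 0 → J a z = 0 := fun a z hz =>
    der_central mul hcomm hnorm_sq e he (J a) (hder a) z (hker z hz)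
  have halt : ∀ a, J a a = 0 := by
    intro a
    have hn : J (J a a) = 0 := by rw [hJ, sub_self]
    have h2 : J (J a (mul a a)) = 0 := by
      rw [hJ]
      ext x
      change mul (mul a a) (mul a x) - mul a (mul (mul a a) x) = 0
      rw [hcomm (mul a a) x, hjordan, hcomm (mul a a), sub_self]
    rw [hder, hcomm (J a a) a, ← two_smul ℝ, map_smul] at h2
    have h3 : J (mul a (J a a)) = 0 := by
      rcases smul_eq_zero.mp h2 with h | h
      · norm_num at h
      · exact h
    have h4 := hdz a _ h3
    rw [hder, hdz a _ hn, map_zero, add_zero] at h4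
    have h5 := hnorm_sq (J a a)
    rw [h4, norm_zero] at h5
    exact norm_eq_zero.mp (pow_eq_zero_iff (two_ne_zero)|>.mp h5.symm)
  have hanti : ∀ a b, J a b = - J b a := by
    intro a b
    have := halt (a + b)
    simp only [map_add, ContinuousLinearMap.add_apply, halt, zero_add, add_zero] at this
    first
      | exact eq_neg_of_add_eq_zero_left this
      | exact eq_neg_of_add_eq_zero_right this
  have hjac : ∀ a b c, J c (J a b) + J a (J b c) + J b (J c a) = 0 := by
    intro a b c
    rw [hanti c, hanti a (J b c), hanti b (J c a), hJ', hJ', hJ', hcomm a c, hcomm b c, hcomm b a]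
    abel
  intro a b
  ext c
  change mul a (mul b c) - mul b (mul a c) = J b (J a c) - J a (J b c)
  have h1 := hjac a b c
  rw [hanti c (J a b), hJ', hanti c a, map_neg] at h1
  have : mul a (mul b c) - mul b (mul a c) - (J b (J a c) - J a (J b c)) = 0 := by
    rw [← h1]; abel
  exact sub_eq_zero.mp this
end

section
/- Let V be a unital JB-algebra with identity e and let δ : V → V be a continuous derivation of the Jordan product. Then δ vanishes on the centre of V: δ(z) = 0 for every z ∈ Z(V) = {z ∈ V : z∘(x∘y) = x∘(z∘y) for all x, y ∈ V}. -/
theorem ks_leib {A : Type*} [Ring A] (d : A → A) (hadd : ∀ x y, d (x + y) = d x + d y)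
    (hmul : ∀ x y, d (x * y) = d x * y + x * d y) (b : A) (hb : d (d b) = 0) (x : A) (m : ℕ) :
    d^[m+1] (b * x) = b * d^[m+1] x + ((m : A) + 1) * (d b * d^[m] x) := by
  have hc : ∀ (k : ℕ) (y : A), d ((k : A) * y) = (k : A) * d y := by
    intro k y
    induction k with
    | zero =>
      have h := hadd 0 0
      simp only [add_zero] at h
      simpa using h
    | succ k ih => push_cast; rw [add_mul, add_mul, hadd, ih]; simp
  induction m with
  | zero => simp [hmul, add_comm]
  | succ m ih =>
    rw [Function.iterate_succ_apply' d (m+1), ih, hadd, hmul]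
    have := hc (m+1) (d b * d^[m] x)
    push_cast at this
    rw [this, hmul, hb, Function.iterate_succ_apply' d (m+1) x, Function.iterate_succ_apply' d m x]
    push_cast
    noncomm_ring

theorem ks_fact {A : Type*} [Ring A] (d : A → A) (hadd : ∀ x y, d (x + y) = d x + d y)
    (hmul : ∀ x y, d (x * y) = d x * y + x * d y) (b : A) (hb : d (d b) = 0) (n : ℕ) :
    d^[n] (b ^ n) = (n.factorial : A) * (d b) ^ n ∧ d^[n+1] (b ^ n) = 0 := by
  have h0 : d 0 = 0 := by
    have h := hadd 0 0
    simpa using h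
  have h1 : d 1 = 0 := by
    have h := hmul 1 1
    simpa using h
  induction n with
  | zero => simp [h1]
  | succ n ih =>
    obtain ⟨i1, i2⟩ := ih
    have key : ∀ m, d^[m+1] (b ^ (n+1)) = b * d^[m+1] (b^n) + ((m : A) + 1) * (d b * d^[m] (b^n)) := by
      intro m; rw [pow_succ']; exact ks_leib d hadd hmul b hb _ m
    constructor
    · rw [key, i2, i1, Nat.factorial_succ, pow_succ', ← mul_assoc (d b), ← Nat.cast_comm,]
      push_cast
      noncomm_ring
    · rw [key, i2, Function.iterate_succ_apply' d (n+1), i2, h0]; simp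

/-- A continuous derivation of a unital JB-algebra vanishes on the
centre. -/
theorem jb_derivation_vanishes_on_centre
    {V : Type*} [NormedAddCommGroup V] [NormedSpace ℝ V] [CompleteSpace V]
    (mul : V →L[ℝ] V →L[ℝ] V)
    (hcomm : ∀ a b : V, mul a b = mul b a)
    (hjordan : ∀ a b : V, mul a (mul b (mul a a)) = mul (mul a b) (mul a a))
    (hnorm_mul : ∀ a b : V, ‖mul a b‖ ≤ ‖a‖ * ‖b‖)
    (hnorm_sq : ∀ a : V, ‖mul a a‖ = ‖a‖ ^ 2)
    (hnorm_add : ∀ a b : V, ‖mul a a‖ ≤ ‖mul a a + mul b b‖)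
    (e : V) (he : ∀ a : V, mul e a = a)
    (δ : V →L[ℝ] V)
    (hder : ∀ a b : V, δ (mul a b) = mul (δ a) b + mul a (δ b))
    (z : V) (hz : ∀ x y : V, mul z (mul x y) = mul x (mul z y)) :
    δ z = 0 := by
  have hw : ∀ x y : V, mul (δ z) (mul x y) = mul x (mul (δ z) y) := by
    intro x y
    have h := congrArg δ (hz x y)
    simp only [hder, map_add] at h
    rw [hz (δ x) y, hz x (δ y)] at h
    have h2 : mul (δ z) (mul x y) + (mul (δ x) (mul z y) + mul x (mul z (δ y)))
      = mul x (mul (δ z) y) + (mul (δ x) (mul z y) + mul x (mul z (δ y))) := by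
      rw [h]; abel
    exact add_right_cancel h2
  set w := δ z with hwdef
  let d : (V →L[ℝ] V) → (V →L[ℝ] V) := fun T => T * mul z - mul z * T
  have hdδ : d δ = mul w := by
    ext x
    simp [d, hder, hwdef]
  have hdd : d (d δ) = 0 := by
    rw [hdδ]
    ext x
    simp [d, hz w x]
  have hfact := fun n => (ks_fact d (by intro x y; simp only [d]; noncomm_ring)
    (by intro x y; simp only [d]; noncomm_ring) δ hdd n).1
  rw [hdδ] at hfact
  have hdn : ∀ T, ‖d T‖ ≤ (2 * ‖mul z‖) * ‖T‖ := by
    intro T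
    calc ‖d T‖ ≤ ‖T * mul z‖ + ‖mul z * T‖ := norm_sub_le _ _
      _ ≤ ‖T‖ * ‖mul z‖ + ‖mul z‖ * ‖T‖ := add_le_add (norm_mul_le _ _) (norm_mul_le _ _)
      _ = _ := by ring
  have hdn' : ∀ n T, ‖d^[n] T‖ ≤ (2 * ‖mul z‖) ^ n * ‖T‖ := by
    intro n T
    induction n with
    | zero => simp
    | succ n ih =>
      rw [Function.iterate_succ_apply']
      refine (hdn _).trans ?_
      rw [pow_succ', mul_assoc (2 * ‖mul z‖) (_ ^ n)]
      exact mul_le_mul_of_nonneg_left ih (by positivity)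
  have hpow : ∀ m x, mul (((mul w) ^ m) e) x = ((mul w) ^ m) x := by
    intro m x
    induction m with
    | zero => simp [he]
    | succ m ih =>
      rw [pow_succ', mul_apply_eq_comp, mul_apply_eq_comp, ← ih,
        hcomm _ x, ← hw, hcomm x]
  have hn2 : ∀ k : ℕ, ‖((mul w) ^ (2 ^ k)) e‖ = ‖w‖ ^ (2 ^ k) := by
    intro k
    induction k with
    | zero => simp [hcomm w e, he]
    | succ k ih =>
      rw [pow_succ 2 k, mul_two, pow_add, mul_apply_eq_comp, ← hpow, hnorm_sq, ih]
      ring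
  by_contra hne
  have hpos : 0 < ‖w‖ := norm_pos_iff.mpr hne
  set C := 2 * ‖mul z‖ * ‖δ‖ with hC
  have hbound : ∀ n : ℕ, 0 < n → (n.factorial : ℝ) * ‖((mul w) ^ n) e‖ ≤ C ^ n * ‖e‖ := by
    intro n hn
    have h1 : ((n.factorial : ℝ) • ((mul w) ^ n) e) = (d^[n] (δ ^ n)) e := by
      rw [hfact, ← nsmul_eq_mul, smul_apply, Nat.cast_smul_eq_nsmul]
    have h2 : ‖(n.factorial : ℝ) • ((mul w) ^ n) e‖ = (n.factorial : ℝ) * ‖((mul w) ^ n) e‖ := by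
      rw [norm_smul]; simp
    rw [← h2, h1]
    refine (ContinuousLinearMap.le_opNorm _ _).trans ?_
    gcongr
    refine (hdn' _ _).trans ?_
    rw [hC, mul_pow _ ‖δ‖]
    gcongr
    exact norm_pow_le' _ hn
  have hlim := ((FloorSemiring.tendsto_pow_div_factorial_atTop (C / ‖w‖)).mul_const ‖e‖).comp
    (tendsto_pow_atTop_atTop_of_one_lt (r := 2) (by norm_num : 1 < 2))
  have hge : ∀ k : ℕ, (1 : ℝ) ≤ (C / ‖w‖) ^ (2 ^ k) / ((2 ^ k).factorial : ℝ) * ‖e‖ := by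
    intro k
    have h := hbound (2 ^ k) (by positivity)
    rw [hn2] at h
    have hf : (0 : ℝ) < ((2 ^ k).factorial : ℝ) := by exact_mod_cast Nat.factorial_pos _
    have hp : 0 < ‖w‖ ^ (2 ^ k) := by positivity
    rw [div_pow, div_div, div_mul_eq_mul_div, le_div_iff₀ (by positivity)]
    linarith
  have := ge_of_tendsto' hlim hge
  norm_num at this
end

section
/- Let V be a unital JB-algebra with identity e, let V₊ = {x² : x ∈ V} be its positive cone, and let Ω be the interior of V₊. For a bounded linear operator X : V → V, the following are equivalent: (i) for all t ∈ ℝ, the operator exponential exp(tX) satisfies exp(tX)(e) = e and exp(tX)(Ω) = Ω; (ii) X is a derivation of the Jordan product, i.e. X(a∘b) = X(a)∘b + a∘X(b) for all a, b ∈ V. -/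
open Set Filter Topology

/-- norm nondecreasing along a dissipative (both signs) linear ODE -/
lemma jb_norm_le {V : Type*} [NormedAddCommGroup V] [NormedSpace ℝ V]
    (v w : ℝ → V) (a b : ℝ) (hab : a ≤ b)
    (hv : ∀ t ∈ Icc a b, HasDerivWithinAt v (w t) (Icc a b) t)
    (hw : ∀ t ∈ Icc a b, ∀ s : ℝ, ‖v t‖ ≤ ‖v t + s • w t‖) : ‖v a‖ ≤ ‖v b‖ := by
  have hc : ContinuousOn v (Icc a b) := fun t ht => (hv t ht).continuousWithinAt
  have := image_le_of_liminf_slope_right_le_deriv_boundary (f := fun t => -‖v t‖) (a := a) (b := b)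
    hc.norm.neg (B := fun _ => -‖v a‖) (B' := fun _ => 0) le_rfl continuousOn_const
    (fun x _ => hasDerivWithinAt_const _ _ _) ?_ (right_mem_Icc.2 hab)
  · simpa using this
  intro x hx r hr
  apply Eventually.frequently
  have hd : HasDerivWithinAt v (w x) (Ioi x) x := by
    have h1 := hv x ⟨hx.1, hx.2.le⟩
    have h2 : HasDerivWithinAt v (w x) (Icc x b) x := h1.mono (Icc_subset_Icc_left hx.1)
    rw [hasDerivWithinAt_iff_isLittleO] at h2 ⊢
    refine h2.mono ?_
    exact (nhdsWithin_le_of_mem (mem_of_superset (Ioc_mem_nhdsGT hx.2) Ioc_subset_Icc_self))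
  rw [hasDerivWithinAt_iff_isLittleO] at hd
  have := hd.def (half_pos hr)
  filter_upwards [this, self_mem_nhdsWithin] with z hz hzx
  have hzx' : 0 < z - x := sub_pos.2 hzx
  rw [slope_def_field, div_lt_iff₀ hzx']
  have h3 := hw x ⟨hx.1, hx.2.le⟩ (z - x)
  rw [Real.norm_of_nonneg hzx'.le] at hz
  have h4 : v x + (z - x) • w x = v z - (v z - v x - (z - x) • w x) := by abel
  have h5 := norm_sub_le (v z) (v z - v x - (z - x) • w x)
  rw [← h4] at h5
  nlinarith

lemma jb_norm_eq {V : Type*} [NormedAddCommGroup V] [NormedSpace ℝ V]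
    (v w : ℝ → V) (a b : ℝ) (hab : a ≤ b)
    (hv : ∀ t ∈ Icc a b, HasDerivWithinAt v (w t) (Icc a b) t)
    (hw : ∀ t ∈ Icc a b, ∀ s : ℝ, ‖v t‖ ≤ ‖v t + s • w t‖) : ‖v a‖ = ‖v b‖ := by
  apply le_antisymm (jb_norm_le v w a b hab hv hw)
  have := jb_norm_le (fun t => v (a + b - t)) (fun t => - w (a + b - t)) a b hab ?_ ?_
  · simpa using this
  · intro t ht
    have hm : MapsTo (fun t => a + b - t) (Icc a b) (Icc a b) := fun s hs =>
      ⟨by linarith [hs.2], by linarith [hs.1]⟩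
    have h1 := hv _ (hm ht)
    have h2 : HasDerivWithinAt (fun t : ℝ => a + b - t) (-1) (Icc a b) t :=
      (hasDerivWithinAt_id t _).const_sub (a + b)
    have := h1.scomp t h2 hm
    simpa [Function.comp_def] using this
  · intro t ht s
    have := hw (a + b - t) ⟨by linarith [ht.2], by linarith [ht.1]⟩ (-s)
    simpa using this

lemma jb_flow_exists {V : Type*} [NormedAddCommGroup V] [NormedSpace ℝ V] [CompleteSpace V]
    (Y : V →L[ℝ] V →L[ℝ] V)
    (hd : ∀ (c v : V) (s : ℝ), ‖v‖ ≤ ‖v + s • Y c v‖) (x₀ : V) :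
    ∃ γ : ℝ → V, γ 0 = x₀ ∧ ∀ t ∈ Icc (-1 : ℝ) 1,
      HasDerivWithinAt γ (Y (γ t) (γ t)) (Icc (-1) 1) t := by
  set R : ℝ := ‖x₀‖ with hR
  have hR0 : 0 ≤ R := norm_nonneg _
  set c : V → ℝ := fun x => max 0 (min 1 (R + 1 - ‖x‖)) with hc
  have hc0 : ∀ x, 0 ≤ c x := fun x => le_max_left _ _
  have hc1 : ∀ x, c x ≤ 1 := fun x => max_le zero_le_one (min_le_left _ _)
  have hcl : ∀ x y, |c x - c y| ≤ ‖x - y‖ := by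
    intro x y
    have h1 : |c x - c y| ≤ |min 1 (R + 1 - ‖x‖) - min 1 (R + 1 - ‖y‖)| := by
      have := abs_max_sub_max_le_abs (min 1 (R + 1 - ‖x‖)) (min 1 (R + 1 - ‖y‖)) 0
      simpa only [hc, max_comm (0:ℝ)] using this
    have h2 : |min 1 (R + 1 - ‖x‖) - min 1 (R + 1 - ‖y‖)| ≤ |(R + 1 - ‖x‖) - (R + 1 - ‖y‖)| := by
      have := abs_min_sub_min_le_max 1 (R + 1 - ‖x‖) 1 (R + 1 - ‖y‖)
      simpa using this
    have h3 : |(R + 1 - ‖x‖) - (R + 1 - ‖y‖)| = |‖x‖ - ‖y‖| := by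
      rw [abs_sub_comm]; congr 1; ring
    linarith [abs_norm_sub_norm_le x y]
  have hcz : ∀ x, R + 1 ≤ ‖x‖ → c x = 0 := by
    intro x hx
    exact max_eq_left ((min_le_right _ _).trans (by linarith))
  have hcR : ∀ x, ‖x‖ ≤ R → c x = 1 := by
    intro x hx
    simp only [hc]
    rw [min_eq_left (by linarith), max_eq_right zero_le_one]
  set M : ℝ := ‖Y‖ with hM
  have hM0 : 0 ≤ M := norm_nonneg Y
  have hYb : ∀ a b, ‖Y a b‖ ≤ M * ‖a‖ * ‖b‖ := fun a b => Y.le_opNorm₂ a b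
  set F : V → V := fun x => c x • Y x x with hF
  have hFb : ∀ x, ‖F x‖ ≤ M * (R + 1) ^ 2 := by
    intro x
    rcases le_total (R + 1) ‖x‖ with h | h
    · simp only [hF, hcz x h, zero_smul, norm_zero]; positivity
    · rw [hF]; simp only [norm_smul, Real.norm_of_nonneg (hc0 x)]
      calc c x * ‖Y x x‖ ≤ 1 * (M * ‖x‖ * ‖x‖) := 
            mul_le_mul (hc1 x) (hYb x x) (norm_nonneg _) zero_le_one
        _ ≤ M * (R + 1) ^ 2 := by
            rw [one_mul, mul_assoc]; gcongr; nlinarith [norm_nonneg x]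
  set A : ℝ := M * (R + 1) ^ 2 with hA
  have hA0 : 0 ≤ A := by positivity
  set B : ℝ := R + A with hB
  have hB0 : 0 ≤ B := by positivity
  set K : ℝ := M * B ^ 2 + 2 * M * B with hK
  have hK0 : 0 ≤ K := by positivity
  have hball : ∀ x ∈ Metric.closedBall x₀ A, ‖x‖ ≤ B := by
    intro x hx
    rw [mem_closedBall_iff_norm] at hx
    have := norm_le_norm_add_norm_sub' x x₀
    linarith
  have hlip : LipschitzOnWith ⟨K, hK0⟩ F (Metric.closedBall x₀ A) := by
    apply LipschitzOnWith.of_dist_le_mul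
    intro x hx y hy
    have hx := hball x hx
    have hy := hball y hy
    rw [dist_eq_norm, dist_eq_norm]
    have e1 : F x - F y = (c x - c y) • Y x x + c y • (Y (x - y) x + Y y (x - y)) := by
      simp only [hF, map_sub, sub_apply]; module
    rw [e1]
    have n1 : ‖(c x - c y) • Y x x‖ ≤ ‖x - y‖ * (M * B ^ 2) := by
      rw [norm_smul]
      apply mul_le_mul (hcl x y) _ (norm_nonneg _) (norm_nonneg _)
      refine (hYb x x).trans ?_
      rw [mul_assoc]; gcongr; nlinarith [norm_nonneg x]
    have n2 : ‖Y (x - y) x + Y y (x - y)‖ ≤ 2 * M * B * ‖x - y‖ := by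
      refine (norm_add_le _ _).trans ?_
      have a1 := hYb (x - y) x
      have a2 := hYb y (x - y)
      have a3 : M * ‖x - y‖ * ‖x‖ ≤ M * ‖x - y‖ * B := by gcongr
      have a4 : M * ‖y‖ * ‖x - y‖ ≤ M * B * ‖x - y‖ := by gcongr
      linarith
    have n3 : ‖c y • (Y (x - y) x + Y y (x - y))‖ ≤ 2 * M * B * ‖x - y‖ := by
      rw [norm_smul, Real.norm_of_nonneg (hc0 y)]
      exact (mul_le_of_le_one_left (norm_nonneg _) (hc1 y)).trans n2
    refine (norm_add_le _ _).trans ?_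
    change _ ≤ K * _
    rw [hK]; linarith
  have hPL : IsPicardLindelof (fun _ => F) (⟨0, by norm_num, by norm_num⟩ : Icc (-1 : ℝ) 1) x₀
      ⟨A, hA0⟩ 0 ⟨A, hA0⟩ ⟨K, hK0⟩ := by
    apply IsPicardLindelof.of_time_independent
    · intro x _; exact hFb x
    · exact hlip
    · simp
  obtain ⟨γ, h0, hγ⟩ := hPL.exists_eq_forall_mem_Icc_hasDerivWithinAt₀
  refine ⟨γ, h0, ?_⟩
  have hdis : ∀ t (s : ℝ), ‖γ t‖ ≤ ‖γ t + s • F (γ t)‖ := by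
    intro t s
    have := hd (γ t) (γ t) (s * c (γ t))
    simpa [hF, smul_smul] using this
  have hnorm : ∀ t ∈ Icc (-1 : ℝ) 1, ‖γ t‖ = R := by
    intro t ht
    have e1 := jb_norm_eq γ (fun t => F (γ t)) (-1) t ht.1
      (fun s hs => (hγ s ⟨hs.1, hs.2.trans ht.2⟩).mono (Icc_subset_Icc_right ht.2))
      (fun s _ => hdis s)
    have e2 := jb_norm_eq γ (fun t => F (γ t)) (-1) 0 (by norm_num)
      (fun s hs => (hγ s ⟨hs.1, hs.2.trans (by norm_num)⟩).mono 
        (Icc_subset_Icc_right (by norm_num)))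
      (fun s _ => hdis s)
    have h0' : γ 0 = x₀ := h0
    rw [← e1, e2, h0']
  intro t ht
  have := hγ t ht
  simpa only [hF, hcR _ (hnorm t ht).le, one_smul] using this

lemma jb_prolongation {V : Type*} [NormedAddCommGroup V] [NormedSpace ℝ V] [CompleteSpace V]
    (Y : V →L[ℝ] V →L[ℝ] V) (hs : ∀ a b, Y a b = Y b a)
    (hd : ∀ (c v : V) (s : ℝ), ‖v‖ ≤ ‖v + s • Y c v‖) (a : V) : Y a a = 0 := by
  choose γ h0 hγ using jb_flow_exists Y hd
  have key : ∀ (u v : ℝ → V) (a b : ℝ), a ≤ b →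
      (∀ t ∈ Icc a b, HasDerivWithinAt u (Y (u t) (u t)) (Icc a b) t) →
      (∀ t ∈ Icc a b, HasDerivWithinAt v (Y (v t) (v t)) (Icc a b) t) →
      ‖u a - v a‖ = ‖u b - v b‖ := by
    intro u v a b hab hu hv
    refine jb_norm_eq (fun t => u t - v t) (fun t => Y (u t + v t) (u t - v t)) a b hab ?_ ?_
    · intro t ht
      have := (hu t ht).sub (hv t ht)
      have e1 : Y (u t + v t) (u t - v t) = Y (u t) (u t) - Y (v t) (v t) := by
        simp only [map_add, map_sub, add_apply, hs (v t) (u t)]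
        abel
      rw [e1]; exact this
    · intro t _ s
      exact hd _ _ _
  have hsub : ∀ t ∈ Icc (0:ℝ) 1, ∀ x, ∀ s ∈ Icc 0 t,
      HasDerivWithinAt (γ x) (Y (γ x s) (γ x s)) (Icc 0 t) s := by
    intro t ht x s hs
    exact (hγ x s ⟨by linarith [hs.1], hs.2.trans ht.2⟩).mono
      (Icc_subset_Icc (by norm_num) ht.2)
  have hlin : ∀ t ∈ Icc (0:ℝ) 1, γ ((2:ℝ) • a) t = (2:ℝ) • γ a t := by
    intro t ht
    have hiso : Isometry (fun x => γ x t) := by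
      apply Isometry.of_dist_eq
      intro x y
      rw [dist_eq_norm, dist_eq_norm, ← key (γ x) (γ y) 0 t ht.1 (hsub t ht x) (hsub t ht y),
        h0, h0]
    have hsurj : Function.Surjective (fun x => γ x t) := by
      intro w
      refine ⟨γ w (-t), ?_⟩
      have := key (γ (γ w (-t))) (fun s => γ w (s - t)) 0 t ht.1 (hsub t ht _) ?_
      · simp only [h0, zero_sub, sub_self, norm_zero] at this
        exact sub_eq_zero.1 (norm_eq_zero.1 this.symm)
      · intro s hs
        have hm : MapsTo (fun s => s - t) (Icc 0 t) (Icc (-1) 1) := fun s hs =>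
          ⟨by linarith [hs.1, ht.2], by linarith [hs.2]⟩
        have h1 := hγ w _ (hm hs)
        have h2 : HasDerivWithinAt (fun s : ℝ => s - t) 1 (Icc 0 t) s :=
          (hasDerivWithinAt_id s _).sub_const t
        have := h1.scomp s h2 hm
        simpa [Function.comp_def] using this
    have hz : γ 0 t = 0 := by
      have := key (γ 0) (fun _ => 0) 0 t ht.1 (hsub t ht _) (by
        intro s _
        simpa using hasDerivWithinAt_const s (Icc 0 t) (0 : V))
      simp only [h0, sub_self, norm_zero, sub_zero] at this
      exact norm_eq_zero.1 this.symm
    let E : V ≃ᵢ V := ⟨Equiv.ofBijective _ ⟨hiso.injective, hsurj⟩, hiso⟩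
    have := (E.toRealLinearIsometryEquivOfMapZero hz).map_smul (2:ℝ) a
    exact this
  have m0 : (0:ℝ) ∈ Icc (0:ℝ) 1 := by norm_num
  have m1 : (1:ℝ) ∈ Icc (0:ℝ) 1 := by norm_num
  have d1 := hsub 1 m1 ((2:ℝ) • a) 0 m0
  have d2 := (hsub 1 m1 a 0 m0).const_smul (2:ℝ)
  have d3 := d2.congr hlin (hlin 0 m0)
  have := (uniqueDiffOn_Icc (zero_lt_one : (0:ℝ) < 1) 0 m0).eq_deriv _ d1 d3
  simp only [h0, map_smul, smul_apply, smul_smul] at this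
  have h4 : (2:ℝ) • Y a a = 0 := by
    have h5 : ((2:ℝ) * 2) • Y a a - (2:ℝ) • Y a a = 0 := sub_eq_zero.2 this
    rw [← h5]; module
  exact (smul_eq_zero.1 h4).resolve_left two_ne_zero

lemma jb_sqrt {V : Type*} [NormedAddCommGroup V] [NormedSpace ℝ V] [CompleteSpace V]
    (mul : V →L[ℝ] V →L[ℝ] V)
    (hcomm : ∀ a b : V, mul a b = mul b a)
    (hnorm_mul : ∀ a b : V, ‖mul a b‖ ≤ ‖a‖ * ‖b‖)
    (e : V) (he : ∀ a : V, mul e a = a)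
    (A : Submodule ℝ V) (hA : IsClosed (A : Set V)) (hsq : ∀ y ∈ A, mul y y ∈ A) (heA : e ∈ A)
    (z : V) (hzA : z ∈ A) (hz : ‖z‖ ≤ 1) : ∃ w ∈ A, mul w w = e - z := by
  let y : ℕ → V := fun n => Nat.rec 0 (fun _ u => (1/2:ℝ) • (z + mul u u)) n
  let r : ℕ → ℝ := fun n => Nat.rec 0 (fun _ u => (1/2:ℝ) * (1 + u * u)) n
  have y0 : y 0 = 0 := rfl
  have ys : ∀ n, y (n+1) = (1/2:ℝ) • (z + mul (y n) (y n)) := fun n => rfl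
  have r0 : r 0 = 0 := rfl
  have rs : ∀ n, r (n+1) = (1/2:ℝ) * (1 + r n * r n) := fun n => rfl
  have hr : ∀ n, 0 ≤ r n ∧ r n ≤ 1 := by
    intro n
    induction n with
    | zero => rw [r0]; norm_num
    | succ n ih => rw [rs]; constructor <;> nlinarith
  have hy : ∀ n, ‖y n‖ ≤ r n := by
    intro n
    induction n with
    | zero => rw [r0, y0]; norm_num
    | succ n ih =>
      rw [rs, ys, norm_smul]
      have h1 := norm_add_le z (mul (y n) (y n))
      have h2 := hnorm_mul (y n) (y n)
      have h3 : ‖y n‖ * ‖y n‖ ≤ r n * r n := mul_le_mul ih ih (norm_nonneg _) (hr n).1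
      have h4 : ‖(1/2:ℝ)‖ = 1/2 := by norm_num
      rw [h4]
      linarith
  have hd : ∀ n, ‖y (n+1) - y n‖ ≤ r (n+1) - r n := by
    intro n
    induction n with
    | zero =>
      rw [y0, r0, sub_zero, sub_zero]; exact hy 1
    | succ n ih =>
      have h1 : y (n+1+1) - y (n+1) = (1/2:ℝ) • mul (y (n+1) - y n) (y (n+1) + y n) := by
        rw [ys (n+1)]
        conv_lhs => rw [sub_eq_add_neg]; arg 2; rw [ys n]
        simp only [map_add, map_sub, sub_apply, hcomm (y (n+1)) (y n)]
        module
      have h2 : r (n+1+1) - r (n+1) = (1/2:ℝ) * ((r (n+1) - r n) * (r (n+1) + r n)) := by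
        rw [rs (n+1)]
        conv_lhs => arg 2; rw [rs n]
        ring
      rw [h1, h2, norm_smul]
      have h4 : ‖(1/2:ℝ)‖ = 1/2 := by norm_num
      rw [h4]
      have h5 := hnorm_mul (y (n+1) - y n) (y (n+1) + y n)
      have h6 : ‖y (n+1) + y n‖ ≤ r (n+1) + r n := (norm_add_le _ _).trans (add_le_add (hy (n+1)) (hy n))
      have h7 := mul_le_mul ih h6 (norm_nonneg _) ((norm_nonneg _).trans ih)
      linarith
  have hsum : Summable (fun n => r (n+1) - r n) := by
    apply summable_of_sum_range_le (c := 1)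
    · intro n; exact (norm_nonneg _).trans (hd n)
    · intro n; rw [Finset.sum_range_sub, r0, sub_zero]; exact (hr n).2
  have hcau : CauchySeq y := by
    apply cauchySeq_of_dist_le_of_summable _ _ hsum
    intro n; rw [dist_comm, dist_eq_norm]; exact hd n
  obtain ⟨u, hu⟩ := cauchySeq_tendsto_of_complete hcau
  have hyA : ∀ n, y n ∈ A := by
    intro n
    induction n with
    | zero => exact A.zero_mem
    | succ n ih => rw [ys]; exact A.smul_mem _ (A.add_mem hzA (hsq _ ih))
  have huA : u ∈ A := hA.mem_of_tendsto hu (Eventually.of_forall hyA)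
  have hlim : u = (1/2:ℝ) • (z + mul u u) := by
    have h1 : Tendsto (fun n => y (n+1)) atTop (𝓝 u) := hu.comp (tendsto_add_atTop_nat 1)
    have h2 : Continuous (fun u : V => (1/2:ℝ) • (z + mul u u)) := by fun_prop
    exact tendsto_nhds_unique h1 ((h2.tendsto u).comp hu)
  refine ⟨e - u, A.sub_mem heA huA, ?_⟩
  have h3 : mul u u = (2:ℝ) • u - z := by
    conv_rhs => arg 1; rw [hlim]
    module
  simp only [map_sub, sub_apply, he, hcomm u e, h3]
  module

section
variable {V : Type*} [NormedAddCommGroup V] [NormedSpace ℝ V]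

lemma jb_lin (mul : V →L[ℝ] V →L[ℝ] V)
    (hcomm : ∀ a b : V, mul a b = mul b a)
    (hjordan : ∀ a b : V, mul a (mul b (mul a a)) = mul (mul a b) (mul a a)) (a b c d : V) :
    mul (mul a b) (mul c d) + mul (mul b c) (mul a d) + mul (mul c a) (mul b d) =
    mul c (mul d (mul a b)) + mul a (mul d (mul b c)) + mul b (mul d (mul c a)) := by
  have h1 := hjordan (a + b + c) d
  have h2 := hjordan (a + b) d
  have h3 := hjordan (b + c) d
  have h4 := hjordan (a + c) d
  have h5 := hjordan a d
  have h6 := hjordan b d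
  have h7 := hjordan c d
  simp only [map_add, add_apply, hcomm b a, hcomm c a, hcomm c b] at h1 h2 h3 h4 ⊢
  rw [hcomm (mul a b) (mul c d), hcomm (mul b c) (mul a d), hcomm (mul a c) (mul b d)]
  linear_combination (norm := module) (-1/2 : ℝ) • (h1 - h2 - h3 - h4 + h5 + h6 + h7)

lemma jb_pow (mul : V →L[ℝ] V →L[ℝ] V)
    (hcomm : ∀ a b : V, mul a b = mul b a)
    (hjordan : ∀ a b : V, mul a (mul b (mul a a)) = mul (mul a b) (mul a a))
    (e : V) (he : ∀ a : V, mul e a = a) (x : V) (m n : ℕ) :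
    mul (((mul x) ^ m) e) (((mul x) ^ n) e) = ((mul x) ^ (m + n)) e := by
  set p : ℕ → V := fun n => ((mul x) ^ n) e with hp
  have p0 : p 0 = e := by simp [hp]
  have ps : ∀ n, p (n+1) = mul x (p n) := by
    intro n; simp only [hp, pow_succ']; rfl
  have hle : mul e = 1 := by ext a; simp [he]
  have ma : ∀ (A B : V →L[ℝ] V) (v : V), (A * B) v = A (B v) := fun _ _ _ => rfl
  let S : Set (V →L[ℝ] V) := {mul x, mul (mul x x)}
  have hmem : ∀ n, mul (p n) ∈ Algebra.adjoin ℝ S ∧ mul (p (n+1)) ∈ Algebra.adjoin ℝ S := by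
    intro n
    have hx : mul x ∈ Algebra.adjoin ℝ S := Algebra.subset_adjoin (by simp [S])
    have hxx : mul (mul x x) ∈ Algebra.adjoin ℝ S := Algebra.subset_adjoin (by simp [S])
    induction n with
    | zero => 
      rw [ps, p0, hle, hcomm x e, he]
      exact ⟨one_mem _, hx⟩
    | succ n ih =>
      refine ⟨ih.2, ?_⟩
      have h1 : mul (p (n+1+1)) = mul (mul x x) * mul (p n) + mul (p (n+1)) * mul x
          + mul (p (n+1)) * mul x - mul x * mul x * mul (p n) - mul (p n) * mul x * mul x := by
        ext v
        have := jb_lin mul hcomm hjordan (p n) v x x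
        simp only [ps, sub_apply, add_apply, ma] at this ⊢
        rw [hcomm (mul (p n) v) (mul x x), hcomm (mul v x) (mul (p n) x), hcomm v x,
          hcomm v (mul x (mul x (p n))), hcomm (p n) x] at this
        linear_combination (norm := module) (-1:ℝ) • this
      rw [h1]
      exact sub_mem (sub_mem (add_mem (add_mem (mul_mem hxx ih.1) (mul_mem ih.2 hx)) (mul_mem ih.2 hx))
        (mul_mem (mul_mem hx hx) ih.1)) (mul_mem (mul_mem ih.1 hx) hx)
  have hcS : ∀ A ∈ S, Commute (mul x) A := by
    intro A hA
    simp only [S, mem_insert_iff, mem_singleton_iff] at hA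
    rcases hA with rfl | rfl
    · exact Commute.refl _
    · ext v
      have := hjordan x v
      simp only [ma]
      rw [hcomm _ v, this, hcomm]
  have hcom : ∀ A ∈ Algebra.adjoin ℝ S, mul x * A = A * mul x := by
    intro A hA
    have : Algebra.adjoin ℝ S ≤ Subalgebra.centralizer ℝ {mul x} := by
      apply Algebra.adjoin_le
      intro A hA
      simp only [Subalgebra.coe_centralizer]
      rw [Set.mem_centralizer_iff]
      intro B hB
      rw [mem_singleton_iff.1 hB]; exact hcS A hA
    have h2 := this hA
    rw [Subalgebra.mem_centralizer_iff] at h2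
    exact h2 _ rfl
  change mul (p m) (p n) = p (m + n)
  induction n with
  | zero => rw [p0, add_zero, hcomm, he]
  | succ n ih =>
    rw [ps, ← add_assoc, ps, ← ih]
    have := congrArg (fun A : V →L[ℝ] V => A (p n)) (hcom _ (hmem m).1)
    exact this.symm

/-- functional calculus square root -/
lemma jb_sqrt_pow [CompleteSpace V] (mul : V →L[ℝ] V →L[ℝ] V)
    (hcomm : ∀ a b : V, mul a b = mul b a)
    (hjordan : ∀ a b : V, mul a (mul b (mul a a)) = mul (mul a b) (mul a a))
    (hnorm_mul : ∀ a b : V, ‖mul a b‖ ≤ ‖a‖ * ‖b‖)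
    (e : V) (he : ∀ a : V, mul e a = a) (x : V) (hx : ‖mul x x‖ ≤ 1) :
    ∃ w, mul w w = e - mul x x ∧ mul (mul x w) (mul x w) = mul (mul x x) (mul w w) := by
  set p : ℕ → V := fun n => ((mul x) ^ n) e with hp
  have hpow : ∀ m n, mul (p m) (p n) = p (m + n) := jb_pow mul hcomm hjordan e he x
  have p0 : p 0 = e := by simp [hp]
  have p1 : p 1 = x := by simp [hp, hcomm x e, he]
  let A0 : Submodule ℝ V := Submodule.span ℝ (range p)
  have hpA : ∀ n, p n ∈ A0 := fun n => Submodule.subset_span ⟨n, rfl⟩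
  have hmulA : ∀ a ∈ A0, ∀ b ∈ A0, mul a b ∈ A0 := by
    intro a ha b hb
    induction ha, hb using Submodule.span_induction₂ with
    | mem_mem a b ha hb =>
      obtain ⟨m, rfl⟩ := ha
      obtain ⟨n, rfl⟩ := hb
      rw [hpow]; exact hpA _
    | zero_left b hb => simp
    | zero_right b hb => simp
    | add_left a b c _ _ _ h1 h2 => rw [map_add]; exact add_mem h1 h2
    | add_right a b c _ _ _ h1 h2 => rw [map_add]; exact add_mem h1 h2
    | smul_left r a b _ _ h => rw [map_smul]; exact A0.smul_mem _ h
    | smul_right r a b _ _ h => rw [map_smul]; exact A0.smul_mem _ h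
  have hassoc : ∀ a ∈ A0, ∀ b ∈ A0, mul (mul x a) (mul x b) = mul (mul x x) (mul a b) := by
    intro a ha b hb
    induction ha, hb using Submodule.span_induction₂ with
    | mem_mem a b ha hb =>
      obtain ⟨m, rfl⟩ := ha
      obtain ⟨n, rfl⟩ := hb
      rw [← p1]
      simp only [hpow]; congr 1; omega
    | zero_left b hb => simp
    | zero_right b hb => simp
    | add_left a b c _ _ _ h1 h2 => simp only [map_add, add_apply, h1, h2]
    | add_right a b c _ _ _ h1 h2 => simp only [map_add, h1, h2]
    | smul_left r a b _ _ h => simp only [map_smul, smul_apply, h]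
    | smul_right r a b _ _ h => simp only [map_smul, h]
  have hcl : ∀ w ∈ A0.topologicalClosure, mul w w ∈ A0.topologicalClosure := by
    intro w hw
    have hc : Continuous (fun u : V => mul u u) := by fun_prop
    exact map_mem_closure (f := fun u : V => mul u u) hc hw (fun u hu => hmulA u hu u hu)
  have hcl2 : ∀ w ∈ A0.topologicalClosure, mul (mul x w) (mul x w) = mul (mul x x) (mul w w) := by
    intro w hw
    have hc : IsClosed {w : V | mul (mul x w) (mul x w) = mul (mul x x) (mul w w)} :=
      isClosed_eq (by fun_prop) (by fun_prop)
    exact closure_minimal (fun u hu => hassoc u hu u hu) hc hw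
  obtain ⟨w, hw, hw2⟩ := jb_sqrt mul hcomm hnorm_mul e he A0.topologicalClosure
    A0.isClosed_topologicalClosure hcl (A0.le_topologicalClosure (p0 ▸ hpA 0)) (mul x x)
    (A0.le_topologicalClosure (hmulA _ (p1 ▸ hpA 1) _ (p1 ▸ hpA 1))) hx
  exact ⟨w, hw2, hcl2 w hw⟩
end

lemma jb_cone {V : Type*} [NormedAddCommGroup V] [NormedSpace ℝ V] [CompleteSpace V]
    (mul : V →L[ℝ] V →L[ℝ] V)
    (hcomm : ∀ a b : V, mul a b = mul b a)
    (hjordan : ∀ a b : V, mul a (mul b (mul a a)) = mul (mul a b) (mul a a))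
    (hnorm_mul : ∀ a b : V, ‖mul a b‖ ≤ ‖a‖ * ‖b‖)
    (hnorm_sq : ∀ a : V, ‖mul a a‖ = ‖a‖ ^ 2)
    (hnorm_add : ∀ a b : V, ‖mul a a‖ ≤ ‖mul a a + mul b b‖)
    (e : V) (he : ∀ a : V, mul e a = a) (S : Set V) (hS : S = {v : V | ∃ x : V, v = mul x x}) :
    ‖e‖ ≤ 1 ∧ (∀ z, ‖z‖ ≤ 1 → e - z ∈ S) ∧ (∀ y ∈ S, ‖y‖ ≤ 1 → ‖e - y‖ ≤ 1) ∧
    (∀ c : ℝ, 0 ≤ c → ∀ y ∈ S, c • y ∈ S) ∧ (∀ y ∈ S, ∀ z ∈ S, y + z ∈ S) ∧ IsClosed S ∧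
    (∀ a, e - a ∈ S → e + a ∈ S → ‖a‖ ≤ 1) := by
  have h1 : ‖e‖ ≤ 1 := by
    have := hnorm_sq e
    rw [he] at this
    nlinarith [norm_nonneg e]
  have h2 : ∀ z, ‖z‖ ≤ 1 → e - z ∈ S := by
    intro z hz
    obtain ⟨w, -, hw⟩ := jb_sqrt mul hcomm hnorm_mul e he ⊤ isClosed_univ (fun _ _ => trivial)
      trivial z trivial hz
    rw [hS]; exact ⟨w, hw.symm⟩
  have h3 : ∀ y ∈ S, ‖y‖ ≤ 1 → ‖e - y‖ ≤ 1 := by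
    intro y hy hn
    have := h2 y hn
    rw [hS] at this hy
    obtain ⟨w, hw⟩ := this
    obtain ⟨x, rfl⟩ := hy
    have := hnorm_add w x
    rw [← hw, sub_add_cancel] at this
    exact this.trans h1
  have h4 : ∀ c : ℝ, 0 ≤ c → ∀ y ∈ S, c • y ∈ S := by
    intro c hc y hy
    rw [hS] at hy ⊢
    obtain ⟨x, rfl⟩ := hy
    refine ⟨Real.sqrt c • x, ?_⟩
    simp only [map_smul, smul_apply, smul_smul, Real.mul_self_sqrt hc]
  have h5 : ∀ y, ∀ M : ℝ, 0 < M → ‖M • e - y‖ ≤ M → y ∈ S := by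
    intro y M hM h
    have a1 : ‖M⁻¹ • (M • e - y)‖ ≤ 1 := by
      rw [norm_smul, norm_inv, Real.norm_of_nonneg hM.le, inv_mul_le_iff₀ hM, mul_one]; exact h
    have a2 := h4 M hM.le _ (h2 _ a1)
    have a3 : M • (e - M⁻¹ • (M • e - y)) = y := by
      rw [smul_sub, smul_smul, mul_inv_cancel₀ hM.ne', one_smul]; abel
    rwa [a3] at a2
  have h6 : ∀ y ∈ S, ∀ M : ℝ, 0 < M → ‖y‖ ≤ M → ‖M • e - y‖ ≤ M := by
    intro y hy M hM h
    have a1 : ‖M⁻¹ • y‖ ≤ 1 := by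
      rw [norm_smul, norm_inv, Real.norm_of_nonneg hM.le, inv_mul_le_iff₀ hM, mul_one]; exact h
    have a2 := h3 _ (h4 M⁻¹ (inv_nonneg.2 hM.le) y hy) a1
    have a3 : M • e - y = M • (e - M⁻¹ • y) := by
      rw [smul_sub, smul_smul, mul_inv_cancel₀ hM.ne', one_smul]
    rw [a3, norm_smul, Real.norm_of_nonneg hM.le]
    nlinarith
  have h7 : ∀ y ∈ S, ∀ z ∈ S, y + z ∈ S := by
    intro y hy z hz
    set M := ‖y‖ + ‖z‖ + 1
    have hM : 0 < M := by positivity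
    have a1 := h6 y hy M hM (by simp only [M]; linarith [norm_nonneg z])
    have a2 := h6 z hz M hM (by simp only [M]; linarith [norm_nonneg y])
    apply h5 _ (M + M) (by linarith)
    have : (M + M) • e - (y + z) = (M • e - y) + (M • e - z) := by module
    rw [this]
    exact (norm_add_le _ _).trans (add_le_add a1 a2)
  have h8 : IsClosed S := by
    have : S = {y | ‖(‖y‖ + 1) • e - y‖ ≤ ‖y‖ + 1} := by
      ext y
      exact ⟨fun h => h6 y h _ (by positivity) (by linarith), fun h => h5 y _ (by positivity) h⟩
    rw [this]
    exact isClosed_le (by fun_prop) (by fun_prop)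
  refine ⟨h1, h2, h3, h4, h7, h8, ?_⟩
  intro a ha1 ha2
  have hp := h4 (1/2) (by norm_num) _ ha2
  have hq := h4 (1/2) (by norm_num) _ ha1
  rw [hS] at hp hq
  obtain ⟨x, hx⟩ := hp
  obtain ⟨u, hu⟩ := hq
  have hxn : ‖mul x x‖ ≤ 1 := by
    refine (hnorm_add x u).trans ?_
    have : mul x x + mul u u = e := by rw [← hx, ← hu]; module
    rw [this]; exact h1
  obtain ⟨w, hw, hw2⟩ := jb_sqrt_pow mul hcomm hjordan hnorm_mul e he x hxn
  have key : mul a a + mul ((2:ℝ) • mul x w) ((2:ℝ) • mul x w) = e := by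
    have ha : a = (2:ℝ) • mul x x - e := by rw [← hx]; module
    have : mul ((2:ℝ) • mul x w) ((2:ℝ) • mul x w) = (4:ℝ) • mul (mul x w) (mul x w) := by
      simp only [map_smul, smul_apply, smul_smul]; norm_num
    rw [this, hw2, hw, ha]
    simp only [map_sub, map_smul, sub_apply, smul_apply, he, hcomm (mul x x) e]
    module
  have := hnorm_add a ((2:ℝ) • mul x w)
  rw [key, hnorm_sq] at this
  nlinarith [norm_nonneg a]

lemma jb_diss {V : Type*} [NormedAddCommGroup V] [NormedSpace ℝ V]
    (e : V) (S : Set V) (h1 : ‖e‖ ≤ 1) (h2 : ∀ z, ‖z‖ ≤ 1 → e - z ∈ S)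
    (h3 : ∀ y ∈ S, ‖y‖ ≤ 1 → ‖e - y‖ ≤ 1)
    (h4 : ∀ c : ℝ, 0 ≤ c → ∀ y ∈ S, c • y ∈ S)
    (h8 : ∀ a, e - a ∈ S → e + a ∈ S → ‖a‖ ≤ 1)
    (Z : V →L[ℝ] V) (hZe : Z e = 0)
    (hZ : ∀ f : V →L[ℝ] ℝ, (∀ y ∈ S, 0 ≤ f y) → ∀ y ∈ S, f y = 0 → f (Z y) = 0)
    (v : V) (s : ℝ) : ‖v‖ ≤ ‖v + s • Z v‖ := by
  have step : ∀ v : V, ‖v‖ = 1 → 2 ≤ ‖e + v‖ → 1 ≤ ‖v + s • Z v‖ := by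
    intro v hv h
    obtain ⟨f, hf1, hf2⟩ := exists_dual_vector'' ℝ (e + v)
    have hfle : ∀ u, f u ≤ ‖u‖ := fun u =>
      (le_abs_self _).trans ((f.le_opNorm u).trans (mul_le_of_le_one_left (norm_nonneg _) hf1))
    have a1 := hfle e
    have a2 := hfle v
    have a3 : f e + f v = ‖e + v‖ := by rw [← map_add]; exact hf2
    have b1 : f e = 1 := by linarith
    have b2 : f v = 1 := by linarith
    have hpos : ∀ y ∈ S, 0 ≤ f y := by
      intro y hy
      have hM : 0 < ‖y‖ + 1 := by positivity
      have c1 : ‖(‖y‖ + 1)⁻¹ • y‖ ≤ 1 := by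
        rw [norm_smul, norm_inv, Real.norm_of_nonneg hM.le, inv_mul_le_iff₀ hM]; linarith
      have c2 := h3 _ (h4 (‖y‖ + 1)⁻¹ (inv_nonneg.2 hM.le) y hy) c1
      have c3 := hfle (e - (‖y‖ + 1)⁻¹ • y)
      rw [map_sub, map_smul, b1, smul_eq_mul] at c3
      have c4 : 0 ≤ (‖y‖ + 1)⁻¹ * f y := by linarith
      exact (mul_nonneg_iff_of_pos_left (inv_pos.2 hM)).1 c4
    have d := hZ f hpos (e - v) (h2 v hv.le) (by rw [map_sub, b1, b2, sub_self])
    rw [map_sub, hZe, zero_sub, map_neg, neg_eq_zero] at d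
    have := hfle (v + s • Z v)
    rwa [map_add, map_smul, d, smul_zero, add_zero, b2] at this
  have dich : ∀ v : V, ‖v‖ = 1 → 2 ≤ ‖e + v‖ ∨ 2 ≤ ‖e + -v‖ := by
    intro v hv
    by_contra! hcon
    obtain ⟨c1, c2⟩ := hcon
    obtain ⟨m, hm1, hm2⟩ : ∃ m, max (max ‖e + v‖ ‖e + -v‖) 1 < m ∧ m < 2 :=
      exists_between (max_lt (max_lt c1 c2) one_lt_two)
    have l1 : ‖e + v‖ ≤ m := ((le_max_left _ _).trans (le_max_left _ _)).trans hm1.le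
    have l2 : ‖e + -v‖ ≤ m := ((le_max_right _ _).trans (le_max_left _ _)).trans hm1.le
    have l3 : 1 < m := (le_max_right _ _).trans_lt hm1
    have hm0 : 0 < m := by linarith
    have hk : 0 < m - 1 := by linarith
    have gen : ∀ u : V, ‖e + u‖ ≤ m → e - (m-1)⁻¹ • u ∈ S := by
      intro u hu
      have a1 : ‖m⁻¹ • (e + u)‖ ≤ 1 := by
        rw [norm_smul, norm_inv, Real.norm_of_nonneg hm0.le, inv_mul_le_iff₀ hm0, mul_one]; exact hu
      have a2 := h4 (m-1)⁻¹ (inv_nonneg.2 hk.le) _ (h4 m hm0.le _ (h2 _ a1))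
      have a3 : (m-1)⁻¹ • m • (e - m⁻¹ • (e + u)) = e - (m-1)⁻¹ • u := by
        rw [smul_sub, smul_smul m, mul_inv_cancel₀ hm0.ne', one_smul]
        have : m • e - (e + u) = (m - 1) • e - u := by module
        rw [this, smul_sub, smul_smul, inv_mul_cancel₀ hk.ne', one_smul]
      rwa [a3] at a2
    have g1 := gen v l1
    have g2 := gen (-v) l2
    rw [smul_neg, sub_neg_eq_add] at g2
    have := h8 _ g1 g2
    rw [norm_smul, norm_inv, Real.norm_of_nonneg hk.le, inv_mul_le_iff₀ hk, hv] at this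
    linarith
  have unit : ∀ v : V, ‖v‖ = 1 → 1 ≤ ‖v + s • Z v‖ := by
    intro v hv
    rcases dich v hv with h | h
    · exact step v hv h
    · have := step (-v) (by rwa [norm_neg]) h
      rwa [map_neg, smul_neg, ← neg_add, norm_neg] at this
  rcases eq_or_ne v 0 with rfl | hv
  · simp
  · have hn : 0 < ‖v‖ := norm_pos_iff.2 hv
    have := unit (‖v‖⁻¹ • v) (by rw [norm_smul, norm_inv, norm_norm, inv_mul_cancel₀ hn.ne'])
    rw [map_smul, smul_comm s, ← smul_add, norm_smul, norm_inv, norm_norm, le_inv_mul_iff₀ hn,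
      mul_one] at this
    exact this

lemma jb_exp_neg {V : Type*} [NormedAddCommGroup V] [NormedSpace ℝ V] [CompleteSpace V]
    (X : V →L[ℝ] V) (t : ℝ) (v : V) :
    NormedSpace.exp (t • X) (NormedSpace.exp ((-t) • X) v) = v := by
  letI : NormedAlgebra ℚ (V →L[ℝ] V) := NormedAlgebra.restrictScalars ℚ ℝ _
  have h : NormedSpace.exp (t • X) * NormedSpace.exp ((-t) • X) = 1 := by
    rw [← NormedSpace.exp_add_of_commute, neg_smul, add_neg_cancel, NormedSpace.exp_zero]
    exact ((Commute.refl X).smul_left t).smul_right (-t)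
  exact congrArg (fun A : V →L[ℝ] V => A v) h

lemma jb_exp_deriv {V : Type*} [NormedAddCommGroup V] [NormedSpace ℝ V] [CompleteSpace V]
    (X : V →L[ℝ] V) (t : ℝ) (v : ℝ → V) (v' : V) (hv : HasDerivAt v v' t) :
    HasDerivAt (fun u : ℝ => NormedSpace.exp (u • X) (v u))
      (NormedSpace.exp (t • X) (X (v t)) + NormedSpace.exp (t • X) v') t :=
  (hasDerivAt_exp_smul_const X t).clm_apply hv

lemma jb_exp_deriv' {V : Type*} [NormedAddCommGroup V] [NormedSpace ℝ V] [CompleteSpace V]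
    (X : V →L[ℝ] V) (t : ℝ) (v : V) :
    HasDerivAt (fun u : ℝ => NormedSpace.exp (u • X) v)
      (X (NormedSpace.exp (t • X) v)) t := by
  have := (hasDerivAt_exp_smul_const' X t).clm_apply (hasDerivAt_const t v)
  simpa using this

lemma jb_exp_deriv_neg {V : Type*} [NormedAddCommGroup V] [NormedSpace ℝ V] [CompleteSpace V]
    (X : V →L[ℝ] V) (t : ℝ) (v : V) :
    HasDerivAt (fun u : ℝ => NormedSpace.exp ((-u) • X) v)
      (-X (NormedSpace.exp ((-t) • X) v)) t := by
  have := (jb_exp_deriv' X (-t) v).scomp t (hasDerivAt_neg t)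
  simpa [Function.comp_def] using this

theorem exp_fixes_unit_and_cone_iff_derivation
    {V : Type*} [NormedAddCommGroup V] [NormedSpace ℝ V] [CompleteSpace V]
    (mul : V →L[ℝ] V →L[ℝ] V)
    (hcomm : ∀ a b : V, mul a b = mul b a)
    (hjordan : ∀ a b : V, mul a (mul b (mul a a)) = mul (mul a b) (mul a a))
    (hnorm_mul : ∀ a b : V, ‖mul a b‖ ≤ ‖a‖ * ‖b‖)
    (hnorm_sq : ∀ a : V, ‖mul a a‖ = ‖a‖ ^ 2)
    (hnorm_add : ∀ a b : V, ‖mul a a‖ ≤ ‖mul a a + mul b b‖)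
    (e : V) (he : ∀ a : V, mul e a = a)
    (X : V →L[ℝ] V) :
    (∀ t : ℝ, NormedSpace.exp (t • X) e = e ∧
        (⇑(NormedSpace.exp (t • X))) '' interior {v : V | ∃ x : V, v = mul x x} =
          interior {v : V | ∃ x : V, v = mul x x}) ↔
    (∀ a b : V, X (mul a b) = mul (X a) b + mul a (X b)) := by
  constructor
  · intro H
    set S : Set V := {v : V | ∃ x : V, v = mul x x} with hS
    obtain ⟨h1, h2, h3, h4, h5, h6, h7⟩ :=
      jb_cone mul hcomm hjordan hnorm_mul hnorm_sq hnorm_add e he S hS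
    have hXe : X e = 0 := by
      have d := jb_exp_deriv' X 0 e
      have d2 : (fun u : ℝ => NormedSpace.exp (u • X) e) = fun _ => e := funext fun u => (H u).1
      rw [d2] at d
      have := d.unique (hasDerivAt_const _ _)
      rwa [(H 0).1] at this
    have hTS : ∀ t : ℝ, ∀ y ∈ S, NormedSpace.exp (t • X) y ∈ S := by
      intro t y hy
      have hint : ∀ ε : ℝ, 0 < ε → y + ε • e ∈ interior S := by
        intro ε hε
        rw [mem_interior]
        refine ⟨Metric.ball (y + ε • e) ε, ?_, Metric.isOpen_ball, Metric.mem_ball_self hε⟩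
        intro u hu
        rw [mem_ball_iff_norm'] at hu
        have a1 : ‖ε⁻¹ • (y + ε • e - u)‖ ≤ 1 := by
          rw [norm_smul, norm_inv, Real.norm_of_nonneg hε.le, inv_mul_le_iff₀ hε, mul_one]
          exact hu.le
        have a2 := h5 y hy _ (h4 ε hε.le _ (h2 _ a1))
        have a3 : y + ε • (e - ε⁻¹ • (y + ε • e - u)) = u := by
          rw [smul_sub, smul_smul, mul_inv_cancel₀ hε.ne', one_smul]; abel
        rwa [a3] at a2
      have hin : ∀ ε : ℝ, 0 < ε → NormedSpace.exp (t • X) y + ε • e ∈ S := by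
        intro ε hε
        have : NormedSpace.exp (t • X) (y + ε • e) ∈ interior S := by
          rw [← (H t).2]; exact mem_image_of_mem _ (hint ε hε)
        rw [map_add, map_smul, (H t).1] at this
        exact interior_subset this
      have hlim : Tendsto (fun ε : ℝ => NormedSpace.exp (t • X) y + ε • e) (𝓝[>] 0)
          (𝓝 (NormedSpace.exp (t • X) y)) := by
        have hc : Continuous (fun ε : ℝ => NormedSpace.exp (t • X) y + ε • e) := by fun_prop
        have := hc.tendsto 0
        rw [zero_smul, add_zero] at this
        exact this.mono_left nhdsWithin_le_nhds
      exact h6.mem_of_tendsto hlim (by filter_upwards [self_mem_nhdsWithin] with ε hε using hin ε hε)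
    have hL : ∀ f : V →L[ℝ] ℝ, (∀ y ∈ S, 0 ≤ f y) → ∀ y ∈ S, f y = 0 → ∀ a, f (mul a y) = 0 := by
      intro f hf
      have hf' : ∀ x, 0 ≤ f (mul x x) := fun x => hf _ ⟨x, rfl⟩
      have cs : ∀ x, f (mul x x) = 0 → ∀ b, f (mul b x) = 0 := by
        intro x hx b
        have q : ∀ l : ℝ, 0 ≤ f (mul b b) + l * (2 * f (mul b x)) := by
          intro l
          have := hf' (b + l • x)
          simp only [map_add, map_smul, add_apply, smul_apply, smul_eq_mul, hx, hcomm x b] at this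
          linarith
        by_contra hne
        have := q (-(f (mul b b) + 1) / (2 * f (mul b x)))
        rw [div_mul_cancel₀ _ (mul_ne_zero two_ne_zero hne)] at this
        linarith
      rintro y ⟨x, rfl⟩ hy a
      apply cs
      have := hjordan x x
      rw [← this, hcomm]
      exact cs x hy _
    let Y : V →L[ℝ] V →L[ℝ] V :=
      (ContinuousLinearMap.compL ℝ V V V X).comp mul
        - ((ContinuousLinearMap.compL ℝ V V V).flip X).comp mul - mul.comp X
    have hY : ∀ a b, Y a b = X (mul a b) - mul a (X b) - mul (X a) b := fun a b => rfl
    have hYs : ∀ a b, Y a b = Y b a := by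
      intro a b
      rw [hY, hY, hcomm b a, hcomm b (X a), hcomm (X b) a]; abel
    have hYd : ∀ (c v : V) (s : ℝ), ‖v‖ ≤ ‖v + s • Y c v‖ := by
      intro c v s
      refine jb_diss e S h1 h2 h3 h4 h7 (Y c) ?_ ?_ v s
      · rw [hY, hXe, hcomm c e, he, map_zero, hcomm, he]; simp
      · intro f hf y hy hfy
        have z : ∀ t : ℝ, f (NormedSpace.exp (t • X) (mul c (NormedSpace.exp ((-t) • X) y))) = 0 := by
          intro t
          refine hL (f.comp (NormedSpace.exp (t • X))) (fun u hu => hf _ (hTS t u hu)) _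
            (hTS (-t) y hy) ?_ c
          change f (NormedSpace.exp (t • X) (NormedSpace.exp ((-t) • X) y)) = 0
          rw [jb_exp_neg, hfy]
        have d1 := (mul c).hasFDerivAt.comp_hasDerivAt (0:ℝ) (jb_exp_deriv_neg X 0 y)
        have d2 := f.hasFDerivAt.comp_hasDerivAt (0:ℝ) (jb_exp_deriv X 0 _ _ d1)
        have d3 : (⇑f ∘ fun u : ℝ => NormedSpace.exp (u • X)
            ((⇑(mul c) ∘ fun u : ℝ => NormedSpace.exp ((-u) • X) y) u)) = fun _ => 0 :=
          funext fun t => z t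
        rw [d3] at d2
        have d4 := d2.unique (hasDerivAt_const _ _)
        simp only [zero_smul, neg_zero, NormedSpace.exp_zero, Function.comp,
          one_apply_eq_self, map_neg, map_add] at d4
        rw [hY, map_sub, map_sub, hL f hf y hy hfy (X c)]
        linarith
    have hQ := jb_prolongation Y hYs hYd
    intro a b
    have q1 := hQ (a + b)
    simp only [map_add, add_apply, hQ a, hQ b, hYs b a] at q1
    have q2 : Y a b = 0 := by
      have : (2:ℝ) • Y a b = 0 := by rw [← q1]; module
      exact (smul_eq_zero.1 this).resolve_left two_ne_zero
    rw [hY, sub_sub, sub_eq_zero] at q2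
    rw [q2, add_comm]
  · intro H
    have hXe : X e = 0 := by
      have := H e e
      rw [he, he, hcomm, he] at this
      simpa using this
    have hmult : ∀ (t : ℝ) (a b : V), NormedSpace.exp (t • X) (mul a b) =
        mul (NormedSpace.exp (t • X) a) (NormedSpace.exp (t • X) b) := by
      intro t a b
      let P : ℝ → V := fun u => mul (NormedSpace.exp (u • X) a) (NormedSpace.exp (u • X) b)
      have hP : ∀ u, HasDerivAt P (X (P u)) u := by
        intro u
        have d1 := (mul.hasFDerivAt.comp_hasDerivAt u (jb_exp_deriv' X u a)).clm_apply
          (jb_exp_deriv' X u b)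
        simp only [P, H]
        exact d1
      have hF : ∀ u, HasDerivAt (fun u : ℝ => NormedSpace.exp (u • (-X)) (P u)) 0 u := by
        intro u
        have := jb_exp_deriv (-X) u P _ (hP u)
        simpa using this
      have hc := is_const_of_deriv_eq_zero (fun u => (hF u).differentiableAt)
        (fun u => (hF u).deriv) t 0
      simp only [P, zero_smul, NormedSpace.exp_zero, one_apply_eq_self] at hc
      rw [← hc]
      have := jb_exp_neg X t
        (mul (NormedSpace.exp (t • X) a) (NormedSpace.exp (t • X) b))
      rw [neg_smul, ← smul_neg] at this
      exact this
    intro t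
    constructor
    · have hF : ∀ u, HasDerivAt (fun u : ℝ => NormedSpace.exp (u • X) e) 0 u := by
        intro u
        have := jb_exp_deriv X u _ _ (hasDerivAt_const u e)
        simpa [hXe] using this
      have hc := is_const_of_deriv_eq_zero (fun u => (hF u).differentiableAt)
        (fun u => (hF u).deriv) t 0
      simpa using hc
    · let E : V ≃ₜ V :=
        { toFun := fun v => NormedSpace.exp (t • X) v
          invFun := fun v => NormedSpace.exp ((-t) • X) v
          left_inv := fun v => by
            have := jb_exp_neg X (-t) v
            rwa [neg_neg] at this
          right_inv := jb_exp_neg X t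
          continuous_toFun := (NormedSpace.exp (t • X)).continuous
          continuous_invFun := (NormedSpace.exp ((-t) • X)).continuous }
      have hE : (⇑(NormedSpace.exp (t • X)) : V → V) = E := rfl
      rw [hE, E.image_interior]
      congr 1
      ext v
      constructor
      · rintro ⟨_, ⟨x, rfl⟩, rfl⟩
        exact ⟨_, hmult t x x⟩
      · rintro ⟨x, rfl⟩
        refine ⟨NormedSpace.exp ((-t) • X) (mul x x), ⟨_, hmult (-t) x x⟩, jb_exp_neg X t _⟩
end
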